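/- Let k be a positive integer with k ≡ 2 (mod 4). Then the sequence 0 → J_{k,1}(O_K) → J_{k,1} → M_k → 0 is exact, where the first map is the restriction π_1 and the second is D_0; that is, π_1 is injective, the image of π_1 equals the kernel of D_0, and D_0 is surjective. -/

import Mathlib

noncomputable section

open Complex

/-- `τ` lies in the upper half plane. -/
def UHP (τ : ℂ) : Prop := 0 < τ.im

/-- `eC w = exp(2 π i w)`. -/
def eC (w : ℂ) : ℂ := Complex.exp (2 * (Real.pi : ℂ) * Complex.I * w)

/-- Entries of a matrix in `SL(2, ℤ)`, as complex numbers. -/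
def Ma (M : Matrix.SpecialLinearGroup (Fin 2) ℤ) : ℂ := ((M.1 0 0 : ℤ) : ℂ)
def Mb (M : Matrix.SpecialLinearGroup (Fin 2) ℤ) : ℂ := ((M.1 0 1 : ℤ) : ℂ)
def Mc (M : Matrix.SpecialLinearGroup (Fin 2) ℤ) : ℂ := ((M.1 1 0 : ℤ) : ℂ)
def Md (M : Matrix.SpecialLinearGroup (Fin 2) ℤ) : ℂ := ((M.1 1 1 : ℤ) : ℂ)

/-- Hermitian Jacobi form of weight `k` and index `m` for the Hermitian Jacobi group over
`ℤ[i]`.  A form is a function `φ : ℂ → ℂ → ℂ → ℂ`, all conditions being imposed for `τ`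
in the upper half plane.  Units `ε ∈ ℤ[i]ˣ = {1, -1, i, -i}`, and the elliptic variables
`λ = p + q i`, `μ = u + v i` range over `ℤ[i]`.  The Fourier expansion is indexed by
`n ∈ ℕ` and `r = (a + b i)/2 ∈ O_K^♯ = (i/2)ℤ[i]`, supported on `N(r) ≤ n m`,
i.e. `a² + b² ≤ 4 n m`. -/
structure IsHJF (k m : ℕ) (φ : ℂ → ℂ → ℂ → ℂ) : Prop where
  holo : DifferentiableOn ℂ (fun p : ℂ × ℂ × ℂ => φ p.1 p.2.1 p.2.2) {p | UHP p.1}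
  transf : ∀ ε : ℂ, ε ∈ ({1, -1, Complex.I, -Complex.I} : Set ℂ) →
    ∀ M : Matrix.SpecialLinearGroup (Fin 2) ℤ, ∀ τ z₁ z₂ : ℂ, UHP τ →
      φ ((Ma M * τ + Mb M) / (Mc M * τ + Md M))
        (ε * z₁ / (Mc M * τ + Md M))
        ((starRingEnd ℂ) ε * z₂ / (Mc M * τ + Md M))
      = ε ^ k * (Mc M * τ + Md M) ^ k *
          eC ((m : ℂ) * Mc M * z₁ * z₂ / (Mc M * τ + Md M)) * φ τ z₁ z₂
  ellip : ∀ p q u v : ℤ, ∀ τ z₁ z₂ : ℂ, UHP τ →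
      φ τ (z₁ + ((p : ℂ) + (q : ℂ) * Complex.I) * τ + ((u : ℂ) + (v : ℂ) * Complex.I))
          (z₂ + ((p : ℂ) - (q : ℂ) * Complex.I) * τ + ((u : ℂ) - (v : ℂ) * Complex.I))
      = eC (-(m : ℂ) * (((p : ℂ) ^ 2 + (q : ℂ) ^ 2) * τ
          + ((p : ℂ) - (q : ℂ) * Complex.I) * z₁
          + ((p : ℂ) + (q : ℂ) * Complex.I) * z₂)) * φ τ z₁ z₂
  fourier : ∃ c : ℕ → ℤ → ℤ → ℂ,
      (∀ (n : ℕ) (a b : ℤ), 4 * (n : ℤ) * m < a ^ 2 + b ^ 2 → c n a b = 0) ∧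
      ∀ τ z₁ z₂ : ℂ, UHP τ →
        HasSum (fun p : ℕ × ℤ × ℤ => c p.1 p.2.1 p.2.2 *
          eC ((p.1 : ℂ) * τ + (((p.2.1 : ℂ) + (p.2.2 : ℂ) * Complex.I) / 2) * z₁
            + (((p.2.1 : ℂ) - (p.2.2 : ℂ) * Complex.I) / 2) * z₂)) (φ τ z₁ z₂)

/-- Classical Jacobi form of weight `k` and index `m` for `SL(2,ℤ) ⋉ ℤ²`. -/
structure IsJF (k m : ℕ) (φ : ℂ → ℂ → ℂ) : Prop where
  holo : DifferentiableOn ℂ (fun p : ℂ × ℂ => φ p.1 p.2) {p | UHP p.1}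
  transf : ∀ M : Matrix.SpecialLinearGroup (Fin 2) ℤ, ∀ τ z : ℂ, UHP τ →
      φ ((Ma M * τ + Mb M) / (Mc M * τ + Md M)) (z / (Mc M * τ + Md M))
      = (Mc M * τ + Md M) ^ k *
          eC ((m : ℂ) * Mc M * z ^ 2 / (Mc M * τ + Md M)) * φ τ z
  ellip : ∀ p q : ℤ, ∀ τ z : ℂ, UHP τ →
      φ τ (z + (p : ℂ) * τ + (q : ℂ))
      = eC (-(m : ℂ) * ((p : ℂ) ^ 2 * τ + 2 * (p : ℂ) * z)) * φ τ z
  fourier : ∃ c : ℕ → ℤ → ℂ,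
      (∀ (n : ℕ) (r : ℤ), 4 * (n : ℤ) * m < r ^ 2 → c n r = 0) ∧
      ∀ τ z : ℂ, UHP τ →
        HasSum (fun p : ℕ × ℤ => c p.1 p.2 * eC ((p.1 : ℂ) * τ + (p.2 : ℂ) * z)) (φ τ z)

/-- Modular form of weight `k` for `SL(2,ℤ)`. -/
structure IsMF (k : ℕ) (f : ℂ → ℂ) : Prop where
  holo : DifferentiableOn ℂ f {τ | UHP τ}
  transf : ∀ M : Matrix.SpecialLinearGroup (Fin 2) ℤ, ∀ τ : ℂ, UHP τ →
      f ((Ma M * τ + Mb M) / (Mc M * τ + Md M)) = (Mc M * τ + Md M) ^ k * f τ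
  bounded : ∃ A B : ℝ, ∀ τ : ℂ, B ≤ τ.im → ‖f τ‖ ≤ A

/-- Cusp form of weight `k` for `SL(2,ℤ)`. -/
structure IsCF (k : ℕ) (f : ℂ → ℂ) : Prop where
  holo : DifferentiableOn ℂ f {τ | UHP τ}
  transf : ∀ M : Matrix.SpecialLinearGroup (Fin 2) ℤ, ∀ τ : ℂ, UHP τ →
      f ((Ma M * τ + Mb M) / (Mc M * τ + Md M)) = (Mc M * τ + Md M) ^ k * f τ
  decay : ∀ ε : ℝ, 0 < ε → ∃ B : ℝ, ∀ τ : ℂ, B ≤ τ.im → ‖f τ‖ ≤ ε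

/-- `M_w(SL(2,ℤ), ω̄)` for the character `ω` of `SL(2,ℤ)` with `ω(T) = ω(S) = i`:
holomorphic functions on the upper half plane, bounded at infinity, with
`f|_w T = -i f` and `f|_w S = -i f`. -/
structure IsMFOmegaBar (w : ℕ) (f : ℂ → ℂ) : Prop where
  holo : DifferentiableOn ℂ f {τ | UHP τ}
  transT : ∀ τ : ℂ, UHP τ → f (τ + 1) = -Complex.I * f τ
  transS : ∀ τ : ℂ, UHP τ → f (-1 / τ) = -Complex.I * τ ^ w * f τ
  bounded : ∃ A B : ℝ, ∀ τ : ℂ, B ≤ τ.im → ‖f τ‖ ≤ A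

/-- Hermitian theta function `θ^H_{m,s}` of index `m` with characteristic
`s = (a + b i)/2 ∈ O_K^♯`; the sum is over `r = s + m (g₁ + g₂ i) ∈ s + m ℤ[i]`. -/
def thetaH (m : ℕ) (a b : ℤ) (τ z₁ z₂ : ℂ) : ℂ :=
  ∑' g : ℤ × ℤ,
    eC ((((a : ℂ) + 2 * m * g.1) ^ 2 + ((b : ℂ) + 2 * m * g.2) ^ 2) / (4 * m) * τ
      + (((a : ℂ) + 2 * m * g.1) + ((b : ℂ) + 2 * m * g.2) * Complex.I) / 2 * z₁
      + (((a : ℂ) + 2 * m * g.1) - ((b : ℂ) + 2 * m * g.2) * Complex.I) / 2 * z₂)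

/-- Classical theta function `θ_{m,μ}(τ,z) = Σ_{r ≡ μ mod 2m} e(r²τ/(4m) + r z)`. -/
def thetaJ (m : ℕ) (μ : ℤ) (τ z : ℂ) : ℂ :=
  ∑' g : ℤ, eC (((μ : ℂ) + 2 * m * g) ^ 2 / (4 * m) * τ + ((μ : ℂ) + 2 * m * g) * z)

/-- `h` is the family of theta components of `φ` (for index `m`): the `h_{a,b}` depend
only on `(a, b) mod 2m` and `φ = Σ_{s ∈ O_K^♯ / m O_K} h_s θ^H_{m,s}`. -/
def HasThetaDecomp (m : ℕ) (φ : ℂ → ℂ → ℂ → ℂ) (h : ℤ → ℤ → ℂ → ℂ) : Prop :=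
  (∀ (a b : ℤ) (τ : ℂ), h (a + 2 * m) b τ = h a b τ ∧ h a (b + 2 * m) τ = h a b τ) ∧
  ∀ τ z₁ z₂ : ℂ, UHP τ →
    φ τ z₁ z₂ = ∑ a ∈ Finset.range (2 * m), ∑ b ∈ Finset.range (2 * m),
      h (a : ℤ) (b : ℤ) τ * thetaH m (a : ℤ) (b : ℤ) τ z₁ z₂

/-- `ϑ₀(τ) = Σ_{r ∈ ℤ} e(r² τ)`. -/
def theta0C (τ : ℂ) : ℂ := ∑' r : ℤ, eC ((r : ℂ) ^ 2 * τ)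

/-- `ϑ₁(τ) = Σ_{r odd} e(r² τ / 4)`. -/
def theta1C (τ : ℂ) : ℂ := ∑' r : ℤ, eC ((2 * (r : ℂ) + 1) ^ 2 * τ / 4)

/-- `ξ = ϑ₁ ϑ₀' − ϑ₀ ϑ₁'`. -/
def xiC (τ : ℂ) : ℂ := theta1C τ * deriv theta0C τ - theta0C τ * deriv theta1C τ

/-- Taylor coefficient `χ_{α,β}(τ)` of `φ(τ, z₁, z₂)` around `z₁ = z₂ = 0`. -/
def chiHJF (φ : ℂ → ℂ → ℂ → ℂ) (α β : ℕ) (τ : ℂ) : ℂ :=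
  (1 / ((α.factorial : ℂ) * (β.factorial : ℂ))) *
    iteratedDeriv α (fun z₁ => iteratedDeriv β (fun z₂ => φ τ z₁ z₂) 0) 0

/-- `D₀ : J_{k,m} → M_k`, `ψ ↦ ψ(·, 0)`. -/
def D0J (ψ : ℂ → ℂ → ℂ) : ℂ → ℂ := fun τ => ψ τ 0

/-- `D₂ : J_{k,m} → S_{k+2}`, `D₂ψ = (2k/(2πi)²) ψ₂ − (2m/(2πi)) ψ₀'`, where `ψ_ν` are
the Taylor coefficients of `ψ` around `z = 0`. -/
def D2J (k m : ℕ) (ψ : ℂ → ℂ → ℂ) : ℂ → ℂ := fun τ =>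
  (2 * (k : ℂ) / (2 * (Real.pi : ℂ) * Complex.I) ^ 2) *
      ((1 / 2) * iteratedDeriv 2 (fun z => ψ τ z) 0)
    - (2 * (m : ℂ) / (2 * (Real.pi : ℂ) * Complex.I)) * deriv (fun t => ψ t 0) τ

/-- Normalized Eisenstein series `E₄`. -/
def E4C (τ : ℂ) : ℂ :=
  1 + 240 * ∑' n : ℕ, ((ArithmeticFunction.sigma 3) n : ℂ) * eC ((n : ℂ) * τ)

/-- Normalized Eisenstein series `E₆`. -/
def E6C (τ : ℂ) : ℂ :=
  1 - 504 * ∑' n : ℕ, ((ArithmeticFunction.sigma 5) n : ℂ) * eC ((n : ℂ) * τ)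

/-- `f` agrees on the upper half plane with a polynomial in `E₄` and `E₆²` that is
homogeneous of weight `k - v`, i.e. supported on `4a + 12b + v = k`. -/
def IsE4E6sqPoly (v k : ℕ) (f : ℂ → ℂ) : Prop :=
  ∃ lam : ℕ × ℕ → ℂ, ∀ τ : ℂ, UHP τ →
    f τ = ∑ p ∈ (Finset.range (k + 1) ×ˢ Finset.range (k + 1)).filter
        (fun p => 4 * p.1 + 12 * p.2 + v = k),
      lam p * E4C τ ^ p.1 * E6C τ ^ (2 * p.2)

/-- The slash action `φ|_{k,m} M` of `M ∈ SL(2,ℤ)` on functions `ℂ → ℂ → ℂ → ℂ`. -/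
def slashHJF (k m : ℕ) (φ : ℂ → ℂ → ℂ → ℂ) (M : Matrix.SpecialLinearGroup (Fin 2) ℤ)
    (τ z₁ z₂ : ℂ) : ℂ :=
  ((Mc M * τ + Md M) ^ k)⁻¹ *
    eC (-(m : ℂ) * Mc M * z₁ * z₂ / (Mc M * τ + Md M)) *
    φ ((Ma M * τ + Mb M) / (Mc M * τ + Md M)) (z₁ / (Mc M * τ + Md M)) (z₂ / (Mc M * τ + Md M))

/-- Hermitian Jacobi form of weight `k` and index `m` for the congruence subgroup `Γ₀(N)`,
with at each cusp a Fourier expansion supported on `(n, r) ∈ ℚ_{≥0} × O_K^♯`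
with `N(r) ≤ n m`. -/
structure IsHJFLevel (k m N : ℕ) (φ : ℂ → ℂ → ℂ → ℂ) : Prop where
  holo : DifferentiableOn ℂ (fun p : ℂ × ℂ × ℂ => φ p.1 p.2.1 p.2.2) {p | UHP p.1}
  transf : ∀ ε : ℂ, ε ∈ ({1, -1, Complex.I, -Complex.I} : Set ℂ) →
    ∀ M : Matrix.SpecialLinearGroup (Fin 2) ℤ, (N : ℤ) ∣ M.1 1 0 →
    ∀ τ z₁ z₂ : ℂ, UHP τ →
      φ ((Ma M * τ + Mb M) / (Mc M * τ + Md M))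
        (ε * z₁ / (Mc M * τ + Md M))
        ((starRingEnd ℂ) ε * z₂ / (Mc M * τ + Md M))
      = ε ^ k * (Mc M * τ + Md M) ^ k *
          eC ((m : ℂ) * Mc M * z₁ * z₂ / (Mc M * τ + Md M)) * φ τ z₁ z₂
  ellip : ∀ p q u v : ℤ, ∀ τ z₁ z₂ : ℂ, UHP τ →
      φ τ (z₁ + ((p : ℂ) + (q : ℂ) * Complex.I) * τ + ((u : ℂ) + (v : ℂ) * Complex.I))
          (z₂ + ((p : ℂ) - (q : ℂ) * Complex.I) * τ + ((u : ℂ) - (v : ℂ) * Complex.I))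
      = eC (-(m : ℂ) * (((p : ℂ) ^ 2 + (q : ℂ) ^ 2) * τ
          + ((p : ℂ) - (q : ℂ) * Complex.I) * z₁
          + ((p : ℂ) + (q : ℂ) * Complex.I) * z₂)) * φ τ z₁ z₂
  cusp : ∀ M : Matrix.SpecialLinearGroup (Fin 2) ℤ,
      ∃ c : ℚ → ℤ → ℤ → ℂ,
        (∀ (n : ℚ) (a b : ℤ),
          ¬ (0 ≤ n ∧ ((a : ℚ) ^ 2 + (b : ℚ) ^ 2) ≤ 4 * n * m) → c n a b = 0) ∧
        ∀ τ z₁ z₂ : ℂ, UHP τ →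
          HasSum (fun p : ℚ × ℤ × ℤ => c p.1 p.2.1 p.2.2 *
            eC ((p.1 : ℂ) * τ + (((p.2.1 : ℂ) + (p.2.2 : ℂ) * Complex.I) / 2) * z₁
              + (((p.2.1 : ℂ) - (p.2.2 : ℂ) * Complex.I) / 2) * z₂))
            (slashHJF k m φ M τ z₁ z₂)

/-- Theta constant `x`. -/
def thConstX (τ : ℂ) : ℂ := ∑' n : ℤ, eC ((n : ℂ) ^ 2 * τ / 2)

/-- Theta constant `y`. -/
def thConstY (τ : ℂ) : ℂ := ∑' n : ℤ, (-1 : ℂ) ^ n * eC ((n : ℂ) ^ 2 * τ / 2)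

/-- Theta constant `z`. -/
def thConstZ (τ : ℂ) : ℂ := ∑' n : ℤ, eC (((n : ℂ) + 1 / 2) ^ 2 * τ / 2)

lemma hasSum_congr' {β : Type*} {f g : β → ℂ} {a : ℂ} (h : HasSum g a) (e : ∀ b, f b = g b) :
    HasSum f a := by
  rwa [funext e]

lemma hasSum_int_even_add_odd {f : ℤ → ℂ} {a b : ℂ} (h0 : HasSum (fun n => f (2 * n)) a)
    (h1 : HasSum (fun n => f (2 * n + 1)) b) : HasSum f (a + b) := by
  have i0 : Function.Injective (fun n : ℤ => 2 * n) := fun x y h => by simpa using h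
  have i1 : Function.Injective (fun n : ℤ => 2 * n + 1) := fun x y h => by simpa using h
  have e0 := i0.hasSum_range_iff (f := f).mpr h0
  have e1 := i1.hasSum_range_iff (f := f).mpr h1
  refine e0.add_isCompl ?_ e1
  rw [isCompl_iff, Set.disjoint_iff, codisjoint_iff]
  constructor
  · rintro x ⟨⟨y, rfl⟩, ⟨w, hw⟩⟩
    simp only at hw
    omega
  · refine Set.eq_univ_of_forall fun x => ?_
    change x ∈ _ ∪ _
    simp only [Set.mem_union, Set.mem_range]
    rcases Int.even_or_odd' x with ⟨y, h | h⟩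
    · exact Or.inl ⟨y, h.symm⟩
    · exact Or.inr ⟨y, h.symm⟩

lemma eC_add (a b : ℂ) : eC (a + b) = eC a * eC b := by
  simp only [eC, mul_add, Complex.exp_add]

lemma eC_zero : eC 0 = 1 := by simp [eC]

lemma eC_ne_zero (a : ℂ) : eC a ≠ 0 := Complex.exp_ne_zero _

lemma eC_int (n : ℤ) : eC n = 1 := by
  rw [eC, show 2 * (Real.pi : ℂ) * I * n = n * (2 * Real.pi * I) by ring,
    Complex.exp_int_mul_two_pi_mul_I]

lemma eC_add_int (a : ℂ) (n : ℤ) : eC (a + n) = eC a := by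
  rw [eC_add, eC_int, mul_one]

lemma eC_half : eC (1 / 2) = -1 := by
  rw [eC, show 2 * (Real.pi : ℂ) * I * (1 / 2) = Real.pi * I by ring, Complex.exp_pi_mul_I]

lemma eC_quarter : eC (1 / 4) = I := by
  rw [eC, show 2 * (Real.pi : ℂ) * I * (1 / 4) = Real.pi / 2 * I by ring, Complex.exp_pi_div_two_mul_I]

lemma eC_neg_mul (a : ℂ) : eC (-a) * eC a = 1 := by
  rw [← eC_add]; simp [eC_zero]

lemma norm_eC (a : ℂ) : ‖eC a‖ = Real.exp (-2 * Real.pi * a.im) := by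
  rw [eC, Complex.norm_exp]
  congr 1
  simp

def t0 (τ z : ℂ) : ℂ := jacobiTheta₂ (2 * z) (2 * τ)
def t1 (τ z : ℂ) : ℂ := eC (τ / 4 + z) * jacobiTheta₂ (2 * z + τ) (2 * τ)

lemma uhp_two {τ : ℂ} (h : UHP τ) : 0 < (2 * τ).im := by
  have : 0 < τ.im := h
  simp; exact this

lemma t0_hasSum {τ : ℂ} (h : UHP τ) (z : ℂ) :
    HasSum (fun n : ℤ => eC ((n : ℂ) ^ 2 * τ + 2 * n * z)) (t0 τ z) := by
  have := hasSum_jacobiTheta₂_term (2 * z) (uhp_two h)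
  refine hasSum_congr' this fun n => ?_
  rw [eC, jacobiTheta₂_term]; congr 1; ring

lemma t1_hasSum {τ : ℂ} (h : UHP τ) (z : ℂ) :
    HasSum (fun n : ℤ => eC ((2 * (n : ℂ) + 1) ^ 2 / 4 * τ + (2 * n + 1) * z)) (t1 τ z) := by
  have := (hasSum_jacobiTheta₂_term (2 * z + τ) (uhp_two h)).mul_left (eC (τ / 4 + z))
  refine hasSum_congr' this fun n => ?_
  rw [eC, eC, jacobiTheta₂_term, ← Complex.exp_add]; congr 1; ring

lemma t0_diff {τ : ℂ} (h : UHP τ) (z : ℂ) :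
    DifferentiableAt ℂ (fun p : ℂ × ℂ => t0 p.1 p.2) (τ, z) := by
  have h1 := (hasFDerivAt_jacobiTheta₂ (2 * z) (uhp_two h)).differentiableAt
  have h2 : DifferentiableAt ℂ (fun p : ℂ × ℂ => ((2 * p.2, 2 * p.1) : ℂ × ℂ)) (τ, z) := by fun_prop
  exact DifferentiableAt.comp (τ, z) (f := fun p : ℂ × ℂ => ((2 * p.2, 2 * p.1) : ℂ × ℂ)) h1 h2

lemma eC_diff : Differentiable ℂ eC := by
  unfold eC; fun_prop

lemma t1_diff {τ : ℂ} (h : UHP τ) (z : ℂ) :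
    DifferentiableAt ℂ (fun p : ℂ × ℂ => t1 p.1 p.2) (τ, z) := by
  have h1 := (hasFDerivAt_jacobiTheta₂ (2 * z + τ) (uhp_two h)).differentiableAt
  have h2 : DifferentiableAt ℂ (fun p : ℂ × ℂ => ((2 * p.2 + p.1, 2 * p.1) : ℂ × ℂ)) (τ, z) := by
    fun_prop
  have h3 := DifferentiableAt.comp (τ, z)
    (f := fun p : ℂ × ℂ => ((2 * p.2 + p.1, 2 * p.1) : ℂ × ℂ)) h1 h2
  have h4 : DifferentiableAt ℂ (fun p : ℂ × ℂ => eC (p.1 / 4 + p.2)) (τ, z) :=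
    DifferentiableAt.comp (τ, z) (f := fun p : ℂ × ℂ => p.1 / 4 + p.2) (eC_diff _) (by fun_prop)
  exact h4.mul h3

lemma t0_ellip {τ : ℂ} (h : UHP τ) (z : ℂ) (p q : ℤ) :
    t0 τ (z + p * τ + q) = eC (-((p : ℂ) ^ 2 * τ + 2 * p * z)) * t0 τ z := by
  have h1 := ((Equiv.addRight p).hasSum_iff.mpr (t0_hasSum h z)).mul_left
    (eC (-((p : ℂ) ^ 2 * τ + 2 * p * z)))
  refine (t0_hasSum h _).unique ?_
  refine hasSum_congr' h1 fun n => ?_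
  simp only [Function.comp, Equiv.coe_addRight]
  rw [← eC_add, ← eC_add_int (-((p : ℂ) ^ 2 * τ + 2 * p * z) + _) (2 * n * q)]
  congr 1; push_cast; ring

lemma t1_ellip {τ : ℂ} (h : UHP τ) (z : ℂ) (p q : ℤ) :
    t1 τ (z + p * τ + q) = eC (-((p : ℂ) ^ 2 * τ + 2 * p * z)) * t1 τ z := by
  have h1 := ((Equiv.addRight p).hasSum_iff.mpr (t1_hasSum h z)).mul_left
    (eC (-((p : ℂ) ^ 2 * τ + 2 * p * z)))
  refine (t1_hasSum h _).unique ?_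
  refine hasSum_congr' h1 fun n => ?_
  simp only [Function.comp, Equiv.coe_addRight]
  rw [← eC_add, ← eC_add_int (-((p : ℂ) ^ 2 * τ + 2 * p * z) + _) ((2 * n + 1) * q)]
  congr 1; push_cast; ring

lemma t0_half {τ : ℂ} (h : UHP τ) (z : ℂ) : t0 τ (z + 1 / 2) = t0 τ z := by
  refine (t0_hasSum h _).unique ?_
  refine hasSum_congr' (t0_hasSum h z) fun n => ?_
  rw [← eC_add_int ((n : ℂ) ^ 2 * τ + 2 * n * z) n]; congr 1; ring

lemma t1_half {τ : ℂ} (h : UHP τ) (z : ℂ) : t1 τ (z + 1 / 2) = - t1 τ z := by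
  refine (t1_hasSum h _).unique ?_
  have := (t1_hasSum h z).mul_left (-1)
  rw [neg_one_mul] at this
  refine hasSum_congr' this fun n => ?_
  rw [← eC_half, ← eC_add, ← eC_add_int (1 / 2 + _) n]; congr 1; ring

lemma t0_neg (τ z : ℂ) : t0 τ (-z) = t0 τ z := by
  rw [t0, mul_neg, jacobiTheta₂_neg_left, t0]

lemma t1_neg {τ : ℂ} (h : UHP τ) (z : ℂ) : t1 τ (-z) = t1 τ z := by
  refine (t1_hasSum h _).unique ?_
  have h1 := ((Equiv.subLeft (-1 : ℤ)).hasSum_iff.mpr (t1_hasSum h z))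
  refine hasSum_congr' h1 fun n => ?_
  simp only [Function.comp, Equiv.subLeft_apply]
  congr 1; push_cast; ring

lemma t0_T {τ : ℂ} (h : UHP τ) (z : ℂ) : t0 (τ + 1) z = t0 τ z := by
  have h' : UHP (τ + 1) := by simpa [UHP] using h
  refine (t0_hasSum h' _).unique ?_
  refine hasSum_congr' (t0_hasSum h z) fun n => ?_
  rw [← eC_add_int ((n : ℂ) ^ 2 * τ + 2 * n * z) (n ^ 2)]; congr 1; push_cast; ring

lemma t1_T {τ : ℂ} (h : UHP τ) (z : ℂ) : t1 (τ + 1) z = I * t1 τ z := by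
  have h' : UHP (τ + 1) := by simpa [UHP] using h
  refine (t1_hasSum h' _).unique ?_
  refine hasSum_congr' ((t1_hasSum h z).mul_left I) fun n => ?_
  rw [← eC_quarter, ← eC_add, ← eC_add_int (1 / 4 + _) (n ^ 2 + n)]; congr 1; push_cast; ring

/-- half-period -/
lemma t1_eq_t0 (τ z : ℂ) : t1 τ z = eC (τ / 4 + z) * t0 τ (z + τ / 2) := by
  rw [t1, t0]; congr 2; ring

lemma t0_halfper (τ z : ℂ) : t0 τ (z + τ / 2) = eC (-(τ / 4 + z)) * t1 τ z := by
  rw [t1_eq_t0, ← mul_assoc, eC_neg_mul, one_mul]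

lemma t1_halfper {τ : ℂ} (h : UHP τ) (z : ℂ) :
    t1 τ (z + τ / 2) = eC (-(τ / 4 + z)) * t0 τ z := by
  have := t0_ellip h z 1 0
  rw [t1_eq_t0, show z + τ / 2 + τ / 2 = z + (1 : ℤ) * τ + (0 : ℤ) by push_cast; ring, this,
    ← mul_assoc, ← eC_add]
  congr 2; push_cast; ring

def sS (τ : ℂ) : ℂ := (-I * (τ / 2)) ^ (1 / 2 : ℂ)

lemma uhp_ne {τ : ℂ} (h : UHP τ) : τ ≠ 0 := by
  rintro rfl; simp [UHP] at h

lemma sS_sq (τ : ℂ) : sS τ ^ 2 = -I * τ / 2 := by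
  rw [sS, ← Complex.cpow_nat_mul]; norm_num; ring

lemma sS_ne {τ : ℂ} (h : UHP τ) : sS τ ≠ 0 := by
  intro h0
  have := sS_sq τ
  rw [h0] at this
  have h1 := uhp_ne h
  have h2 := I_ne_zero
  have h3 : I * τ = 0 := by linear_combination 2 * this
  exact (mul_ne_zero h2 h1) h3

lemma uhp_S {τ : ℂ} (h : UHP τ) : UHP (-1 / τ) := by
  have : 0 < τ.im := h
  have h0 := uhp_ne h
  rw [UHP, neg_div, neg_im, one_div, inv_im]
  have := Complex.normSq_pos.mpr h0
  rw [neg_div, neg_neg]; positivity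

lemma t01_sum {τ : ℂ} (h : UHP τ) (z : ℂ) :
    jacobiTheta₂ z (τ / 2) = t0 τ z + t1 τ z := by
  have h2 : 0 < (τ / 2).im := by
    have : 0 < τ.im := h
    simp; exact this
  have hs := hasSum_jacobiTheta₂_term z h2
  refine hs.unique ?_
  refine hasSum_int_even_add_odd (f := fun n => jacobiTheta₂_term n z (τ / 2)) (hasSum_congr' (t0_hasSum h z) fun n => ?_) (hasSum_congr' (t1_hasSum h z) fun n => ?_) <;>
  · rw [eC, jacobiTheta₂_term]; congr 1; push_cast; ring

lemma t0_S {τ : ℂ} (h : UHP τ) (z : ℂ) :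
    t0 (-1 / τ) (z / τ) = sS τ * eC (z ^ 2 / τ) * (t0 τ z + t1 τ z) := by
  have h0 := uhp_ne h
  rw [← t01_sum h, jacobiTheta₂_functional_equation z (τ / 2), t0, ← sS]
  have : cexp (-Real.pi * I * z ^ 2 / (τ / 2)) = eC (-(z ^ 2 / τ)) := by
    rw [eC]; congr 1; field_simp
  rw [this, show z / (τ / 2) = 2 * (z / τ) by field_simp, show -1 / (τ / 2) = 2 * (-1 / τ) by field_simp]
  have e := eC_neg_mul (z ^ 2 / τ)
  have := sS_ne h
  field_simp
  linear_combination (-(jacobiTheta₂ (2 * z / τ) (-(2 / τ)))) * e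

lemma t1_S {τ : ℂ} (h : UHP τ) (z : ℂ) :
    t1 (-1 / τ) (z / τ) = sS τ * eC (z ^ 2 / τ) * (t0 τ z - t1 τ z) := by
  have h0 := uhp_ne h
  rw [t1_eq_t0, show z / τ + -1 / τ / 2 = (z - 1 / 2) / τ by field_simp; ring, t0_S h]
  have a := t0_half h (z - 1 / 2)
  have b := t1_half h (z - 1 / 2)
  rw [sub_add_cancel] at a b
  rw [← a, b, mul_comm (sS τ), mul_assoc, mul_assoc, ← mul_assoc, ← eC_add]
  rw [show -1 / τ / 4 + z / τ + (z - 1 / 2) ^ 2 / τ = z ^ 2 / τ by field_simp; ring]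
  ring

lemma M_det (M : Matrix.SpecialLinearGroup (Fin 2) ℤ) : Ma M * Md M - Mb M * Mc M = 1 := by
  have := M.2
  rw [Matrix.det_fin_two] at this
  unfold Ma Mb Mc Md
  exact_mod_cast this

lemma M_mul (M N : Matrix.SpecialLinearGroup (Fin 2) ℤ) :
    Ma (M * N) = Ma M * Ma N + Mb M * Mc N ∧ Mb (M * N) = Ma M * Mb N + Mb M * Md N ∧
    Mc (M * N) = Mc M * Ma N + Md M * Mc N ∧ Md (M * N) = Mc M * Mb N + Md M * Md N := by
  unfold Ma Mb Mc Md
  simp [Matrix.mul_apply, Fin.sum_univ_two]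

lemma M_inv (M : Matrix.SpecialLinearGroup (Fin 2) ℤ) :
    Ma M⁻¹ = Md M ∧ Mb M⁻¹ = - Mb M ∧ Mc M⁻¹ = - Mc M ∧ Md M⁻¹ = Ma M := by
  unfold Ma Mb Mc Md
  simp [Matrix.SpecialLinearGroup.SL2_inv_expl]

lemma M_j_ne (M : Matrix.SpecialLinearGroup (Fin 2) ℤ) {τ : ℂ} (h : UHP τ) :
    Mc M * τ + Md M ≠ 0 := by
  intro h0
  have h' : 0 < τ.im := h
  have hi := congrArg Complex.im h0
  have hr := congrArg Complex.re h0
  have hd := M_det M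
  unfold Ma Mb Mc Md at *
  simp at hi hr
  rcases hi with hi | hi
  · simp [hi] at hr
    simp [hi, hr] at hd
  · exact h'.ne' hi

lemma M_uhp (M : Matrix.SpecialLinearGroup (Fin 2) ℤ) {τ : ℂ} (h : UHP τ) :
    UHP ((Ma M * τ + Mb M) / (Mc M * τ + Md M)) := by
  have h' : 0 < τ.im := h
  have hj := M_j_ne M h
  have hd := M_det M
  rw [UHP, Complex.div_im]
  have hn := Complex.normSq_pos.mpr hj
  rw [← sub_div]
  refine div_pos ?_ hn
  unfold Ma Mb Mc Md at *
  have hd' : (M.1 0 0 : ℝ) * (M.1 1 1 : ℝ) - (M.1 0 1 : ℝ) * (M.1 1 0 : ℝ) = 1 := by exact_mod_cast hd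
  simp
  have : (M.1 0 0 : ℝ) * τ.im * ((M.1 1 0 : ℝ) * τ.re + (M.1 1 1 : ℝ)) -
    ((M.1 0 0 : ℝ) * τ.re + (M.1 0 1 : ℝ)) * ((M.1 1 0 : ℝ) * τ.im) = τ.im := by
    linear_combination τ.im * hd'
  linarith

lemma alg1 {a b c d cM dM τ w q J j : ℂ} (hJ : J = cM * w + dM) (hj : j = c * τ + d)
    (hJ0 : J ≠ 0) (hj0 : j ≠ 0) (hw : w = (a * τ + b) / j) (hd : a * d - b * c = 1) :
    (cM * a + dM * c) * q / (J * j) = cM * (j⁻¹ ^ 2 * q) / J + c * q / j := by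
  have hw' : w * j = a * τ + b := by rw [hw]; field_simp
  rw [inv_pow]
  field_simp
  subst hJ
  have : a * j = c * (a * τ + b) + 1 := by rw [hj]; linear_combination hd
  linear_combination q * cM * this - q * c * cM * hw'

lemma alg2 {a b c d τ j : ℂ} (hj : j = -c * τ + a) (hj0 : j ≠ 0) (hd : a * d - b * c = 1) :
    c * ((d * τ + -b) / j) + d = j⁻¹ := by
  field_simp
  rw [hj]; linear_combination hd

lemma alg3 {a b c d τ j : ℂ} (hj : j = -c * τ + a) (hj0 : j ≠ 0) (hd : a * d - b * c = 1) :
    a * ((d * τ + -b) / j) + b = τ * j⁻¹ := by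
  field_simp
  rw [hj]; linear_combination τ * hd

theorem sl2_ext {E : Type*} [AddCommGroup E] [Module ℂ E] (Q : E → ℂ)
    (hQ : ∀ (c : ℂ) z, Q (c • z) = c ^ 2 * Q z) (F : ℂ → E → ℂ) (k : ℕ)
    (hT : ∀ τ z, UHP τ → F (τ + 1) z = F τ z)
    (hS : ∀ τ z, UHP τ → F (-1 / τ) (τ⁻¹ • z) = τ ^ k * eC (Q z / τ) * F τ z)
    (M : Matrix.SpecialLinearGroup (Fin 2) ℤ) :
    ∀ τ z, UHP τ → F ((Ma M * τ + Mb M) / (Mc M * τ + Md M)) ((Mc M * τ + Md M)⁻¹ • z)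
      = (Mc M * τ + Md M) ^ k * eC (Mc M * Q z / (Mc M * τ + Md M)) * F τ z := by
  have hM : M ∈ Subgroup.closure {ModularGroup.S, ModularGroup.T} := by
    rw [SpecialLinearGroup.SL2Z_generators]; trivial
  induction hM using Subgroup.closure_induction with
  | mem x hx =>
    intro τ z h
    rcases hx with rfl | rfl
    · have := hS τ z h
      simpa [Ma, Mb, Mc, Md, ModularGroup.S] using this
    · have := hT τ z h
      simpa [Ma, Mb, Mc, Md, ModularGroup.T, eC_zero] using this
  | one =>
    intro τ z h
    simp [Ma, Mb, Mc, Md, eC_zero]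
  | mul M N _ _ ihM ihN =>
    intro τ z h
    have hj := M_j_ne N h
    have hu := M_uhp N h
    have hj2 := M_j_ne M hu
    have h1 := ihM _ ((Mc N * τ + Md N)⁻¹ • z) hu
    rw [ihN τ z h, hQ] at h1
    obtain ⟨ea, eb, ec, ed⟩ := M_mul M N
    have hdN := M_det N
    have hJ : Mc (M * N) * τ + Md (M * N) =
      (Mc M * ((Ma N * τ + Mb N) / (Mc N * τ + Md N)) + Md M) * (Mc N * τ + Md N) := by
      rw [ec, ed]; field_simp; ring
    have hA : (Ma (M * N) * τ + Mb (M * N)) =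
      (Ma M * ((Ma N * τ + Mb N) / (Mc N * τ + Md N)) + Mb M) * (Mc N * τ + Md N) := by
      rw [ea, eb]; field_simp; ring
    rw [smul_smul] at h1
    rw [hJ, hA, mul_div_mul_right _ _ hj, mul_inv, h1, mul_pow]
    have : eC (Mc (M * N) * Q z / ((Mc M * ((Ma N * τ + Mb N) / (Mc N * τ + Md N)) + Md M) *
        (Mc N * τ + Md N))) =
        eC (Mc M * ((Mc N * τ + Md N)⁻¹ ^ 2 * Q z) /
          (Mc M * ((Ma N * τ + Mb N) / (Mc N * τ + Md N)) + Md M)) *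
        eC (Mc N * Q z / (Mc N * τ + Md N)) := by
      rw [← eC_add]
      congr 1
      rw [ec]
      exact alg1 rfl rfl hj2 hj rfl hdN
    rw [this]; ring
  | inv M _ ihM =>
    intro τ z h
    have hj := M_j_ne M⁻¹ h
    have hu := M_uhp M⁻¹ h
    have h1 := ihM _ ((Mc M⁻¹ * τ + Md M⁻¹)⁻¹ • z) hu
    have hj2 := M_j_ne M hu
    have hd := M_det M
    obtain ⟨ea, eb, ec, ed⟩ := M_inv M
    have hJ : Mc M * ((Ma M⁻¹ * τ + Mb M⁻¹) / (Mc M⁻¹ * τ + Md M⁻¹)) + Md M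
        = (Mc M⁻¹ * τ + Md M⁻¹)⁻¹ := by
      rw [ea, eb]
      exact alg2 (by rw [ec, ed]) hj hd
    have hA : Ma M * ((Ma M⁻¹ * τ + Mb M⁻¹) / (Mc M⁻¹ * τ + Md M⁻¹)) + Mb M
        = τ * (Mc M⁻¹ * τ + Md M⁻¹)⁻¹ := by
      rw [ea, eb]
      exact alg3 (by rw [ec, ed]) hj hd
    rw [hJ, hA, hQ, smul_smul, inv_inv, mul_inv_cancel₀ hj, one_smul, div_inv_eq_mul, mul_assoc,
      inv_mul_cancel₀ hj, mul_one] at h1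
    rw [h1]
    have e := eC_neg_mul (Mc M⁻¹ * Q z / (Mc M⁻¹ * τ + Md M⁻¹))
    have e2 : Mc M * ((Mc M⁻¹ * τ + Md M⁻¹)⁻¹ ^ 2 * Q z) / (Mc M⁻¹ * τ + Md M⁻¹)⁻¹
       = -(Mc M⁻¹ * Q z / (Mc M⁻¹ * τ + Md M⁻¹)) := by
      generalize hjj : Mc M⁻¹ * τ + Md M⁻¹ = j at *
      rw [ec]
      field_simp
    rw [e2, inv_pow]
    have hjk := pow_ne_zero k hj
    generalize Mc M⁻¹ * τ + Md M⁻¹ = j at *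
    generalize F _ _ = X
    generalize eC (Mc M⁻¹ * Q z / j) = E1 at *
    generalize eC (-(Mc M⁻¹ * Q z / j)) = E2 at *
    have h3 := mul_inv_cancel₀ hjk
    linear_combination (-X) * e - X * E1 * E2 * h3

open Filter Topology in
lemma w1_lim : Tendsto (fun τ : ℂ => jacobiTheta₂ τ (2*τ)) (comap Complex.im atTop) (𝓝 2) := by
  have hs : Summable (fun n : ℤ => ‖jacobiTheta₂_term n I (2*I)‖) := by
    refine ((summable_jacobiTheta₂_term_iff I (2*I)).mpr ?_).norm
    simp
  have key : ∀ n : ℤ, ∀ τ : ℂ, ‖jacobiTheta₂_term n τ (2*τ)‖ = Real.exp (-2*Real.pi*((n^2+n : ℤ):ℝ)*τ.im) := by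
    intro n τ
    rw [norm_jacobiTheta₂_term]
    congr 1
    simp
    ring
  have hnn : ∀ n : ℤ, 0 ≤ n^2+n := by
    intro n
    rcases le_or_gt 0 n with h | h <;> nlinarith
  have h := tendsto_tsum_of_dominated_convergence (𝓕 := comap Complex.im atTop)
    (f := fun (τ:ℂ) (n : ℤ) => jacobiTheta₂_term n τ (2*τ))
    (g := fun n : ℤ => if n ∈ ({0,-1} : Finset ℤ) then (1:ℂ) else 0) hs ?_ ?_
  · rw [tsum_eq_sum (s := {0,-1})] at h
    · rw [Finset.sum_ite_mem] at h
      norm_num at h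
      exact h
    · intro b hb; simp only [hb, if_false]
  · intro n
    split_ifs with hn
    · have : ∀ τ : ℂ, jacobiTheta₂_term n τ (2*τ) = 1 := by
        intro τ
        simp at hn
        rcases hn with rfl | rfl
        · simp [jacobiTheta₂_term]
        · simp [jacobiTheta₂_term]; ring_nf; simp
      simp only [this]
      exact tendsto_const_nhds
    · have h1 : 1 ≤ n^2+n := by
        have := hnn n
        have h2 : n^2+n ≠ 0 := by
          intro h0
          have : n*(n+1) = 0 := by linarith
          rcases mul_eq_zero.mp this with h | h
          · exact hn (by simp [h])
          · exact hn (by simp; right; omega)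
        omega
      rw [tendsto_zero_iff_norm_tendsto_zero]
      simp only [key]
      refine Real.tendsto_exp_atBot.comp ?_
      have h3 : (0:ℝ) < ((n^2+n : ℤ):ℝ) := by exact_mod_cast h1
      refine Tendsto.const_mul_atTop_of_neg ?_ tendsto_comap
      have := Real.pi_pos
      nlinarith [mul_pos this h3]
  · have : ∀ᶠ τ : ℂ in comap Complex.im atTop, 1 ≤ τ.im := tendsto_comap.eventually (eventually_ge_atTop 1)
    filter_upwards [this] with τ hτ n
    rw [key n I, key n τ]
    apply Real.exp_le_exp.mpr
    have h3 : (0:ℝ) ≤ ((n^2+n : ℤ):ℝ) := by exact_mod_cast hnn n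
    have := Real.pi_pos
    simp only [I_im]
    have := mul_nonneg this.le h3
    nlinarith

open Filter Topology in
lemma x_lim : Tendsto (fun τ : ℂ => t0 τ 0) (comap Complex.im atTop) (𝓝 1) := by
  have h := isBigO_at_im_infty_jacobiTheta_sub_one
  have h2 : Tendsto (fun τ => jacobiTheta τ - 1) (comap Complex.im atTop) (𝓝 0) := by
    refine h.trans_tendsto ?_
    refine Real.tendsto_exp_atBot.comp ?_
    refine Tendsto.const_mul_atTop_of_neg ?_ tendsto_comap
    linarith [Real.pi_pos]
  have h3 : Tendsto (fun τ : ℂ => 2*τ) (comap Complex.im atTop) (comap Complex.im atTop) := by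
    rw [tendsto_comap_iff]
    have : (Complex.im ∘ fun τ : ℂ => 2*τ) = fun τ : ℂ => 2 * τ.im := by ext; simp
    rw [this]
    exact Tendsto.const_mul_atTop (by norm_num) tendsto_comap
  have h4 := (h2.comp h3).add_const 1
  simp only [zero_add] at h4
  refine h4.congr ?_
  intro τ
  simp [t0, jacobiTheta_eq_jacobiTheta₂]

lemma t1_eq_w (τ : ℂ) : t1 τ 0 = eC (τ/4) * jacobiTheta₂ τ (2*τ) := by simp [t1]

open Filter Topology in
lemma eC_lim {c : ℝ} (hc : 0 < c) : Tendsto (fun τ : ℂ => eC (τ*c)) (comap Complex.im atTop) (𝓝 0) := by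
  rw [tendsto_zero_iff_norm_tendsto_zero]
  simp only [norm_eC]
  refine Real.tendsto_exp_atBot.comp ?_
  refine Tendsto.const_mul_atTop_of_neg (by linarith [Real.pi_pos]) ?_
  have : (fun τ : ℂ => (τ*c).im) = fun τ : ℂ => c * τ.im := by ext; simp [mul_comm]
  rw [this]
  exact Tendsto.const_mul_atTop hc tendsto_comap

open Filter Topology in
lemma y_lim : Tendsto (fun τ : ℂ => t1 τ 0) (comap Complex.im atTop) (𝓝 0) := by
  have h := (eC_lim (c := 1/4) (by norm_num)).mul w1_lim
  rw [zero_mul] at h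
  refine h.congr ?_
  intro τ
  rw [t1_eq_w]
  congr 2
  push_cast; ring

/-- filter of going to i∞ -/
def iinf : Filter ℂ := Filter.comap Complex.im Filter.atTop

open UpperHalfPlane Filter Topology in
lemma tendsto_coe_iinf : Tendsto ((↑) : UpperHalfPlane → ℂ) atImInfty iinf := by
  rw [iinf, tendsto_comap_iff]
  exact tendsto_comap

open UpperHalfPlane Filter Topology in
lemma tendsto_ofComplex_iinf : Tendsto ofComplex iinf atImInfty := by
  rw [atImInfty, tendsto_comap_iff]
  have h0 : Tendsto Complex.im iinf atTop := tendsto_comap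
  refine h0.congr' ?_
  filter_upwards [h0.eventually (eventually_gt_atTop 0)] with τ hτ
  simp [ofComplex_apply_of_im_pos hτ, UpperHalfPlane.im]

open Filter in
lemma iinf_uhp : ∀ᶠ τ in iinf, UHP τ := by
  have h0 : Tendsto Complex.im iinf atTop := tendsto_comap
  exact h0.eventually (eventually_gt_atTop 0)

open UpperHalfPlane in
lemma mdiff_of (f : ℂ → ℂ) (hf : DifferentiableOn ℂ f {τ | UHP τ}) :
   MDifferentiable (modelWithCornersSelf ℂ ℂ) (modelWithCornersSelf ℂ ℂ) (fun τ : UpperHalfPlane => f τ) := by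
  rw [UpperHalfPlane.mdifferentiable_iff]
  refine hf.congr ?_
  intro τ hτ
  simp [ofComplex_apply_of_im_pos hτ]

open UpperHalfPlane Filter Topology Asymptotics in
theorem per_expand (f : ℂ → ℂ) (hf : DifferentiableOn ℂ f {τ | UHP τ})
    (hT : ∀ τ, UHP τ → f (τ+1) = f τ) (hb : f =O[iinf] (fun _ => (1:ℝ))) :
    ∃ a : ℕ → ℂ, (∀ τ, UHP τ → HasSum (fun n : ℕ => a n * eC (n*τ)) (f τ)) ∧ Tendsto f iinf (𝓝 (a 0)) := by
  set F : UpperHalfPlane → ℂ := fun τ => f τ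
  have hper : Function.Periodic (F ∘ ofComplex) (1:ℝ) := by
    intro w
    by_cases hw : 0 < w.im
    · have : 0 < (w + ((1:ℝ):ℂ)).im := by simpa using hw
      simp only [Function.comp, F, ofComplex_apply_of_im_pos hw, ofComplex_apply_of_im_pos this]
      simpa using hT w hw
    · have : ¬ 0 < (w + ((1:ℝ):ℂ)).im := by simpa using hw
      simp only [Function.comp, F, ofComplex_apply_of_im_nonpos (not_lt.mp hw), ofComplex_apply_of_im_nonpos (not_lt.mp this)]
  have hm := mdiff_of f hf
  have hB : IsBoundedAtImInfty F := hb.comp_tendsto tendsto_coe_iinf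
  refine ⟨fun n => (qExpansion 1 F).coeff n, ?_, ?_⟩
  · intro τ hτ
    have := hasSum_qExpansion one_pos hper hm hB ⟨τ, hτ⟩
    refine hasSum_congr' this ?_
    intro n
    simp only [smul_eq_mul]
    congr 1
    simp [Function.Periodic.qParam, eC, ← Complex.exp_nat_mul]
    ring_nf
  · have han := analyticAt_cuspFunction_zero one_pos hper hm hB
    have : Tendsto F atImInfty (𝓝 (cuspFunction 1 F 0)) := by
      have := han.continuousAt.tendsto.comp (qParam_tendsto_atImInfty (one_pos (α := ℝ)))
      refine this.congr ?_
      intro τ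
      exact eq_cuspFunction τ one_ne_zero hper
    have h2 : (qExpansion 1 F).coeff 0 = cuspFunction 1 F 0 := by
      simp [qExpansion_coeff]
    simp only [h2]
    refine (this.comp tendsto_ofComplex_iinf).congr' ?_
    filter_upwards [iinf_uhp] with τ hτ
    simp [F, ofComplex_apply_of_im_pos hτ]

/-- level one forms -/
structure ML (k : ℕ) (f : ℂ → ℂ) : Prop where
  holo : DifferentiableOn ℂ f {τ | UHP τ}
  T : ∀ τ, UHP τ → f (τ+1) = f τ
  S : ∀ τ, UHP τ → f (-1/τ) = τ^k * f τ
  bd : f =O[iinf] (fun _ => (1:ℝ))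

lemma ML.add {k f g} (hf : ML k f) (hg : ML k g) : ML k (fun τ => f τ + g τ) :=
  ⟨hf.holo.add hg.holo, fun τ h => by rw [hf.T τ h, hg.T τ h],
   fun τ h => by rw [hf.S τ h, hg.S τ h]; ring, hf.bd.add hg.bd⟩

lemma ML.mul {k l f g} (hf : ML k f) (hg : ML l g) : ML (k+l) (fun τ => f τ * g τ) :=
  ⟨hf.holo.mul hg.holo, fun τ h => by rw [hf.T τ h, hg.T τ h],
   fun τ h => by rw [hf.S τ h, hg.S τ h]; ring, by simpa using hf.bd.mul hg.bd⟩

lemma ML.const (c : ℂ) : ML 0 (fun _ => c) :=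
  ⟨differentiableOn_const _, fun τ h => rfl,
   fun τ h => by simp, Asymptotics.isBigO_const_const _ one_ne_zero _⟩

lemma ML.smul {k f} (c : ℂ) (hf : ML k f) : ML k (fun τ => c * f τ) := by
  simpa using (ML.const c).mul hf

lemma ML.pow {k f} (hf : ML k f) (n : ℕ) : ML (k*n) (fun τ => f τ ^ n) := by
  induction n with
  | zero => simpa using ML.const 1
  | succ n ih => simpa [pow_succ, mul_add] using ih.mul hf

open Filter Topology in
lemma ML.lim {k f} (hf : ML k f) : ∃ c, Tendsto f iinf (𝓝 c) := by
  obtain ⟨a, -, h⟩ := per_expand f hf.holo hf.T hf.bd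
  exact ⟨_, h⟩

open Filter Topology UpperHalfPlane MatrixGroups ModularForm Matrix.SpecialLinearGroup in
lemma slashS (F : UpperHalfPlane → ℂ) (k : ℤ) (z : UpperHalfPlane) :
    (F ∣[k] ModularGroup.S) z = F (ofComplex (-1/(z:ℂ))) * (z:ℂ) ^ (-k) := by
  rw [SL_slash_apply, ModularGroup.denom_S]
  congr 2
  rw [ofComplex_apply_of_im_pos (uhp_S z.2)]
  rw [UpperHalfPlane.modular_S_smul]
  apply UpperHalfPlane.ext
  simp [neg_div, inv_neg]

open Filter Topology UpperHalfPlane MatrixGroups ModularForm Matrix.SpecialLinearGroup in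
lemma slashT (F : UpperHalfPlane → ℂ) (k : ℤ) (z : UpperHalfPlane) :
    (F ∣[k] ModularGroup.T) z = F (ofComplex ((z:ℂ)+1)) := by
  rw [SL_slash_apply]
  have : denom (ModularGroup.T : SL(2,ℤ)) z = 1 := by
    rw [ModularGroup.denom_apply]; simp [ModularGroup.coe_T]
  rw [this, one_zpow, mul_one]
  congr 1
  have h : 0 < ((z:ℂ)+1).im := by simpa using z.2
  rw [ofComplex_apply_of_im_pos h, UpperHalfPlane.modular_T_smul]
  apply UpperHalfPlane.ext
  simp [add_comm]

open Filter Topology UpperHalfPlane MatrixGroups ModularForm Matrix.SpecialLinearGroup in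
lemma ML.slash {k f} (hf : ML k f) (γ : SL(2, ℤ)) : (fun τ : UpperHalfPlane => f τ) ∣[(k:ℤ)] γ = (fun τ : UpperHalfPlane => f τ) := by
  refine SlashInvariantForm.slash_action_generators_SL2Z ?_ ?_ γ
  · ext z
    rw [slashS, ofComplex_apply_of_im_pos (uhp_S z.2)]
    change f (-1/(z:ℂ)) * _ = _
    rw [hf.S z z.2, zpow_neg, zpow_natCast]
    have hz := pow_ne_zero k (uhp_ne z.2)
    field_simp
  · ext z
    have h : 0 < ((z:ℂ)+1).im := by simpa using z.2
    rw [slashT, ofComplex_apply_of_im_pos h]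
    exact hf.T z z.2

open Filter Topology UpperHalfPlane MatrixGroups ModularForm Matrix.SpecialLinearGroup in
lemma ML.of_slash {k : ℕ} (F : UpperHalfPlane → ℂ) (hd : MDifferentiable (modelWithCornersSelf ℂ ℂ) (modelWithCornersSelf ℂ ℂ) F)
    (hS : F ∣[(k:ℤ)] ModularGroup.S = F) (hT : F ∣[(k:ℤ)] ModularGroup.T = F) (hb : IsBoundedAtImInfty F) :
    ML k (fun τ => F (ofComplex τ)) := by
  refine ⟨UpperHalfPlane.mdifferentiable_iff.mp hd, ?_, ?_, hb.comp_tendsto tendsto_ofComplex_iinf⟩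
  · intro τ h
    have e := congrFun hT ⟨τ, h⟩
    rw [slashT] at e
    rw [ofComplex_apply_of_im_pos h]
    exact e
  · intro τ h
    have e := congrFun hS ⟨τ, h⟩
    rw [slashS, zpow_neg, zpow_natCast] at e
    rw [ofComplex_apply_of_im_pos h, ← e]
    have hz := pow_ne_zero k (uhp_ne h)
    field_simp

open Filter Topology UpperHalfPlane MatrixGroups ModularForm Matrix.SpecialLinearGroup in
lemma ML.toMF {k f} (hf : ML k f) : ∃ F : ModularForm 𝒮ℒ (k:ℤ), ∀ τ : UpperHalfPlane, F τ = f τ :=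
  ⟨{ toFun := fun τ => f τ
     slash_action_eq' A hA := by
       obtain ⟨A, rfl⟩ := hA
       exact hf.slash A
     holo' := mdiff_of f hf.holo
     bdd_at_cusps' hc := by
       rw [OnePoint.isBoundedAt_iff_forall_SL2Z hc]
       intro γ _
       rw [hf.slash]
       exact hf.bd.comp_tendsto tendsto_coe_iinf }, fun τ => rfl⟩

open Filter Topology UpperHalfPlane MatrixGroups ModularForm Matrix.SpecialLinearGroup in
lemma ML.toCF {k f} (hf : ML k f) (h0 : Tendsto f iinf (𝓝 0)) : ∃ F : CuspForm 𝒮ℒ (k:ℤ), ∀ τ : UpperHalfPlane, F τ = f τ :=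
  ⟨{ toFun := fun τ => f τ
     slash_action_eq' A hA := by
       obtain ⟨A, rfl⟩ := hA
       exact hf.slash A
     holo' := mdiff_of f hf.holo
     zero_at_cusps' hc := by
       rw [OnePoint.isZeroAt_iff_forall_SL2Z hc]
       intro γ _
       rw [hf.slash]
       exact h0.comp tendsto_coe_iinf }, fun τ => rfl⟩

open Filter Topology UpperHalfPlane MatrixGroups ModularForm Matrix.SpecialLinearGroup in
lemma ML.ofMF {k : ℕ} (F : ModularForm 𝒮ℒ (k:ℤ)) : ML k (fun τ => F (ofComplex τ)) :=
  ML.of_slash F (ModularFormClass.holo F) (F.slash_action_eq' _ ⟨ModularGroup.S, rfl⟩)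
    (F.slash_action_eq' _ ⟨ModularGroup.T, rfl⟩) (ModularFormClass.bdd_at_infty F)

open Filter Topology UpperHalfPlane MatrixGroups ModularForm Matrix.SpecialLinearGroup in
lemma ML.zero_of_lt {k f} (hf : ML k f) (h0 : Tendsto f iinf (𝓝 0)) (hk : k < 12) :
    ∀ τ, UHP τ → f τ = 0 := by
  obtain ⟨F, hF⟩ := hf.toCF h0
  have := rank_zero_iff_forall_zero.mp (CuspForm.rank_eq_zero_of_weight_lt_twelve (k := k) (by omega)) F
  intro τ h
  rw [← hF ⟨τ, h⟩, this]; rfl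

open Filter Topology UpperHalfPlane MatrixGroups ModularForm Matrix.SpecialLinearGroup in
lemma ML.zero_two {f} (hf : ML 2 f) : ∀ τ, UHP τ → f τ = 0 := by
  obtain ⟨F, hF⟩ := hf.toMF
  have := rank_zero_iff_forall_zero.mp levelOne_weight_two_rank_zero F
  intro τ h
  rw [← hF ⟨τ, h⟩, this]; rfl

open Filter Topology UpperHalfPlane MatrixGroups ModularForm Matrix.SpecialLinearGroup in
lemma ML.div_disc {k f} (hf : ML (k+12) f) (h0 : Tendsto f iinf (𝓝 0)) :
    ∃ g, ML k g ∧ ∀ τ, UHP τ → f τ = discriminant (ofComplex τ) * g τ := by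
  obtain ⟨F, hF⟩ := hf.toCF h0
  have e : ((k+12 : ℕ):ℤ) - 12 = k := by push_cast; ring
  refine ⟨_, ML.ofMF (ModularForm.mcast e (CuspForm.discriminantEquiv F)), ?_⟩
  intro τ h
  have := discriminant_mul_discriminantEquiv_apply F ⟨τ, h⟩
  rw [hF] at this
  rw [ofComplex_apply_of_im_pos h]
  exact this.symm

open Filter Topology UpperHalfPlane MatrixGroups ModularForm Matrix.SpecialLinearGroup in
lemma ML.disc : ML 12 (fun τ => discriminant (ofComplex τ)) :=
  ML.of_slash discriminant (CuspFormClass.holo CuspForm.discriminant) discriminant_S_invariant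
    discriminant_T_invariant (discriminant_isZeroAtImInfty.isBoundedAtImInfty)

/-- theta constants -/
def X (τ : ℂ) : ℂ := t0 τ 0
def Y (τ : ℂ) : ℂ := t1 τ 0

lemma X_holo : DifferentiableOn ℂ X {τ | UHP τ} := by
  intro τ h
  have := t0_diff h 0
  have h2 : DifferentiableAt ℂ (fun τ : ℂ => ((τ, 0) : ℂ × ℂ)) τ := by fun_prop
  exact (DifferentiableAt.comp (f := fun τ : ℂ => ((τ, 0) : ℂ × ℂ)) τ this h2).differentiableWithinAt

lemma Y_holo : DifferentiableOn ℂ Y {τ | UHP τ} := by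
  intro τ h
  have := t1_diff h 0
  have h2 : DifferentiableAt ℂ (fun τ : ℂ => ((τ, 0) : ℂ × ℂ)) τ := by fun_prop
  exact (DifferentiableAt.comp (f := fun τ : ℂ => ((τ, 0) : ℂ × ℂ)) τ this h2).differentiableWithinAt

lemma X_T {τ} (h : UHP τ) : X (τ+1) = X τ := t0_T h 0
lemma Y_T {τ} (h : UHP τ) : Y (τ+1) = I * Y τ := t1_T h 0
lemma X_S {τ} (h : UHP τ) : X (-1/τ) = sS τ * (X τ + Y τ) := by
  have := t0_S h 0
  simpa [X, Y, eC_zero] using this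
lemma Y_S {τ} (h : UHP τ) : Y (-1/τ) = sS τ * (X τ - Y τ) := by
  have := t1_S h 0
  simpa [X, Y, eC_zero] using this

open Filter Topology in
lemma X_lim : Tendsto X iinf (𝓝 1) := x_lim
open Filter Topology in
lemma Y_lim : Tendsto Y iinf (𝓝 0) := y_lim

lemma I4 : (I:ℂ)^4 = 1 := Complex.I_pow_four

lemma sS4 {τ} (h : UHP τ) : sS τ ^ 4 = -τ^2/4 := by
  have := sS_sq τ
  have e : sS τ^4 = (sS τ^2)^2 := by ring
  rw [e, this]; ring_nf; rw [Complex.I_sq]; ring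

def F6 (τ : ℂ) : ℂ := X τ^12 - 33 * X τ^8 * Y τ^4 - 33 * X τ^4 * Y τ^8 + Y τ^12
def F4 (τ : ℂ) : ℂ := X τ^8 + 14 * X τ^4 * Y τ^4 + Y τ^8
def PD (τ : ℂ) : ℂ := X τ^4 * Y τ^4 * (X τ^4 - Y τ^4)^4

open Filter Topology in
lemma F6_lim : Tendsto F6 iinf (𝓝 1) := by
  have := (((X_lim.pow 12).sub (((X_lim.pow 8).const_mul 33).mul (Y_lim.pow 4))).sub (((X_lim.pow 4).const_mul 33).mul (Y_lim.pow 8))).add (Y_lim.pow 12)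
  norm_num at this
  exact this
open Filter Topology in
lemma F4_lim : Tendsto F4 iinf (𝓝 1) := by
  have := ((X_lim.pow 8).add (((X_lim.pow 4).const_mul 14).mul (Y_lim.pow 4))).add (Y_lim.pow 8)
  norm_num at this
  exact this
open Filter Topology in
lemma PD_lim : Tendsto PD iinf (𝓝 0) := by
  have := ((X_lim.pow 4).mul (Y_lim.pow 4)).mul (((X_lim.pow 4).sub (Y_lim.pow 4)).pow 4)
  norm_num at this
  exact this

lemma F6_ML : ML 6 F6 := by
  refine ⟨?_, ?_, ?_, F6_lim.isBigO_one ℝ⟩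
  · have hx := X_holo
    have hy := Y_holo
    unfold F6
    fun_prop
  · intro τ h
    unfold F6
    rw [X_T h, Y_T h]
    have e8 : (I:ℂ)^8 = 1 := by rw [show (8:ℕ) = 4*2 by rfl, pow_mul, I4]; ring
    have e12 : (I:ℂ)^12 = 1 := by rw [show (12:ℕ) = 4*3 by rfl, pow_mul, I4]; ring
    simp only [mul_pow, I4, e8, e12, one_mul]
  · intro τ h
    unfold F6
    rw [X_S h, Y_S h]
    have e : sS τ^12 = (-τ^2/4)^3 := by rw [← sS4 h]; ring
    have : ∀ s x y : ℂ, (s*(x+y))^12 - 33 * (s*(x+y))^8*(s*(x-y))^4 - 33 * (s*(x+y))^4*(s*(x-y))^8 + (s*(x-y))^12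
      = s^12 * (-64 * (x^12 - 33*x^8*y^4-33*x^4*y^8+y^12)) := by intros; ring
    rw [this, e]; ring

lemma F4_ML : ML 4 F4 := by
  refine ⟨?_, ?_, ?_, F4_lim.isBigO_one ℝ⟩
  · have hx := X_holo
    have hy := Y_holo
    unfold F4
    fun_prop
  · intro τ h
    unfold F4
    rw [X_T h, Y_T h]
    have e8 : (I:ℂ)^8 = 1 := by rw [show (8:ℕ) = 4*2 by rfl, pow_mul, I4]; ring
    simp only [mul_pow, I4, e8, one_mul]
  · intro τ h
    unfold F4
    rw [X_S h, Y_S h]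
    have e : sS τ^8 = (-τ^2/4)^2 := by rw [← sS4 h]; ring
    have : ∀ s x y : ℂ, (s*(x+y))^8 + 14 * (s*(x+y))^4*(s*(x-y))^4 + (s*(x-y))^8
      = s^8 * (16 * (x^8 + 14*x^4*y^4+y^8)) := by intros; ring
    rw [this, e]; ring

lemma PD_ML : ML 12 PD := by
  refine ⟨?_, ?_, ?_, PD_lim.isBigO_one ℝ⟩
  · have hx := X_holo
    have hy := Y_holo
    unfold PD
    fun_prop
  · intro τ h
    unfold PD
    rw [X_T h, Y_T h]
    simp only [mul_pow, I4, one_mul]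
  · intro τ h
    unfold PD
    rw [X_S h, Y_S h]
    have e : sS τ^24 = (-τ^2/4)^6 := by rw [← sS4 h]; ring
    have : ∀ s x y : ℂ, (s*(x+y))^4*(s*(x-y))^4*((s*(x+y))^4-(s*(x-y))^4)^4
      = s^24 * (4096 * (x^4*y^4*(x^4-y^4)^4)) := by intros; ring
    rw [this, e]; ring

open Filter Topology in
lemma PD_ev : ∀ᶠ τ in iinf, PD τ ≠ 0 := by
  have h1 := ((X_lim.pow 4).sub (Y_lim.pow 4))
  norm_num at h1
  have hw : Tendsto (fun τ : ℂ => jacobiTheta₂ τ (2*τ)) iinf (𝓝 2) := w1_lim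
  filter_upwards [X_lim.eventually_ne one_ne_zero, h1.eventually_ne one_ne_zero, hw.eventually_ne two_ne_zero] with τ a b c
  have hy : Y τ ≠ 0 := by
    rw [Y, t1_eq_w]
    exact mul_ne_zero (eC_ne_zero _) c
  exact mul_ne_zero (mul_ne_zero (pow_ne_zero _ a) (pow_ne_zero _ hy)) (pow_ne_zero _ b)

instance : Filter.NeBot iinf := by
  refine Filter.comap_neBot ?_
  intro t ht
  obtain ⟨a, ha⟩ := (Filter.nonempty_of_mem ht)
  exact ⟨a * I, by simpa using ha⟩

open UpperHalfPlane Filter in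
lemma PD_ne {τ} (h : UHP τ) : PD τ ≠ 0 := by
  obtain ⟨g, hg, e⟩ := ML.div_disc (k := 0) PD_ML PD_lim
  obtain ⟨F, hF⟩ := hg.toMF
  obtain ⟨c, hc⟩ := ModularFormClass.levelOne_weight_zero_const (F : ModularForm _ 0)
  have hgc : ∀ τ, UHP τ → g τ = c := by
    intro τ h
    rw [← hF ⟨τ, h⟩]
    exact congrFun hc _
  obtain ⟨τ', h1, h2⟩ := (PD_ev.and iinf_uhp).exists
  have hc0 : c ≠ 0 := by
    rintro rfl
    apply h1
    rw [e _ h2, hgc _ h2, mul_zero]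
  rw [e _ h, hgc _ h]
  exact mul_ne_zero (ModularForm.discriminant_ne_zero _) hc0

lemma X_ne {τ} (h : UHP τ) : X τ ≠ 0 := by
  have := PD_ne h
  intro h0
  apply this
  simp [PD, h0]

lemma Y_ne {τ} (h : UHP τ) : Y τ ≠ 0 := by
  have := PD_ne h
  intro h0
  apply this
  simp [PD, h0]

open Filter Topology UpperHalfPlane in
theorem ML.factor : ∀ (m : ℕ) (f : ℂ → ℂ), ML (4*m+2) f →
    (∃ j g, 4*m+2 = j+6 ∧ ML j g ∧ ∀ τ, UHP τ → f τ = g τ * F6 τ) ∨ (∀ τ, UHP τ → f τ = 0) := by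
  intro m
  induction m using Nat.strong_induction_on with
  | _ m ih =>
  intro f hf
  rcases Nat.eq_zero_or_pos m with rfl | hm
  · right
    exact ML.zero_two hf
  left
  obtain ⟨n, rfl⟩ : ∃ n, m = n+1 := ⟨m-1, by omega⟩
  obtain ⟨c, hc⟩ := hf.lim
  have hB : ML (4*n) (fun τ => c * F4 τ ^ n) := (F4_ML.pow n).smul c
  have hBl : Tendsto (fun τ => c * F4 τ ^ n) iinf (𝓝 c) := by
    simpa using (F4_lim.pow n).const_mul c
  have hBF := hB.mul F6_ML
  have h1 : ML (4*(n+1)+2) (fun τ => f τ + (-1) * (c * F4 τ ^ n * F6 τ)) := hf.add (hBF.smul (-1))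
  have hl : Tendsto (fun τ => f τ + (-1) * (c * F4 τ ^ n * F6 τ)) iinf (𝓝 0) := by
    have := hc.add ((hBl.mul F6_lim).const_mul (-1))
    simpa using this
  rcases lt_or_ge (4*(n+1)+2) 12 with h12 | h12
  · have := h1.zero_of_lt hl h12
    refine ⟨4*n, _, by ring, hB, ?_⟩
    intro τ h
    have := this τ h
    linear_combination this
  · obtain ⟨p, rfl⟩ : ∃ p, n = p + 2 := ⟨n-2, by omega⟩
    obtain ⟨g, hg, e⟩ := ML.div_disc (k := 4*p+2) h1 hl
    rcases ih p (by omega) g hg with ⟨j, g', hj, hg', e'⟩ | hz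
    · refine ⟨4*(p+2), fun τ => c * F4 τ ^ (p+2) + ModularForm.discriminant (ofComplex τ) * g' τ, by ring, ?_, ?_⟩
      · refine hB.add ?_
        have : 4*(p+2) = 12 + j := by omega
        rw [this]
        exact ML.disc.mul hg'
      · intro τ h
        have := e τ h
        rw [e' τ h] at this
        linear_combination this
    · refine ⟨4*(p+2), _, by ring, hB, ?_⟩
      intro τ h
      have := e τ h
      rw [hz τ h] at this
      linear_combination this

lemma shift_int (H : ℂ → ℂ) (hH : Differentiable ℂ H) (hp : ∀ z, H (z+1) = H z) (w : ℂ) :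
    ∫ x in (0:ℝ)..1, H (x + w) = ∫ x in (0:ℝ)..1, H x := by
  obtain ⟨P, hP⟩ := hH.isExactOn_univ
  have hd : ∀ z, HasDerivAt P (H z) z := fun z => hP z trivial
  have key : ∀ w : ℂ, ∫ x in (0:ℝ)..1, H (x + w) = P (1 + w) - P w := by
    intro w
    have := intervalIntegral.integral_eq_sub_of_hasDerivAt (a := 0) (b := 1) (f := fun x : ℝ => P (x + w))
      (f' := fun x : ℝ => H (x+w)) ?_ ?_
    · simpa using this
    · intro x _
      have h1 : HasDerivAt (fun z : ℂ => P (z + w)) (H (x+w)) (x:ℂ) := by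
        simpa using (hd (x+w)).comp_add_const (x:ℂ) w
      exact h1.comp_ofReal
    · apply Continuous.intervalIntegrable
      exact hH.continuous.comp (by fun_prop)
  have hD : ∀ w, P (1+w) - P w = P (1+0) - P 0 := by
    intro w
    have hdd : ∀ z, HasDerivAt (fun w => P (1+w) - P w) 0 z := by
      intro z
      have h1 := ((hd (1+z)).comp_const_add (1:ℂ) z).sub (hd z)
      have : H (1+z) - H z = 0 := by rw [add_comm, hp, sub_self]
      rwa [this] at h1
    exact is_const_of_deriv_eq_zero (fun z => (hdd z).differentiableAt) (fun z => (hdd z).deriv) w 0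
  rw [key w, hD w, ← key 0]
  simp

lemma t0_entire {τ : ℂ} (h : UHP τ) : Differentiable ℂ (t0 τ) := by
  intro z
  have h2 : DifferentiableAt ℂ (fun z : ℂ => ((τ, z) : ℂ × ℂ)) z := by fun_prop
  exact DifferentiableAt.comp (f := fun z : ℂ => ((τ, z) : ℂ × ℂ)) z (t0_diff h z) h2

lemma t1_entire {τ : ℂ} (h : UHP τ) : Differentiable ℂ (t1 τ) := by
  intro z
  have h2 : DifferentiableAt ℂ (fun z : ℂ => ((τ, z) : ℂ × ℂ)) z := by fun_prop
  exact DifferentiableAt.comp (f := fun z : ℂ => ((τ, z) : ℂ × ℂ)) z (t1_diff h z) h2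

theorem theta1d {τ : ℂ} (h : UHP τ) (g : ℂ → ℂ) (hg : Differentiable ℂ g) (h1 : ∀ z, g (z+1) = g z)
    (hτ : ∀ z, g (z+τ) = eC (-τ-2*z) * g z) : ∃ A B : ℂ, ∀ z, g z = A * t0 τ z + B * t1 τ z := by
  set C : ℤ → ℂ := fun r => ∫ x in (0:ℝ)..1, g x * eC (-(r * x)) with hC
  have hrec : ∀ r : ℤ, C (r+2) = eC ((r+1)*τ) * C r := by
    intro r
    have hs := shift_int (fun z => g z * eC (-(r * z))) (hg.mul (eC_diff.comp (by fun_prop))) ?_ τ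
    · have : ∀ x : ℝ, g (x+τ) * eC (-(r*(x+τ))) = eC (-((r+1)*τ)) * (g x * eC (-(((r+2:ℤ):ℂ) * x))) := by
        intro x
        rw [hτ, mul_comm (eC _) (g x), mul_assoc, ← eC_add, mul_left_comm, ← eC_add]
        congr 2
        push_cast; ring
      simp only [this] at hs
      rw [intervalIntegral.integral_const_mul] at hs
      have e := eC_neg_mul ((r+1)*τ)
      have hs' : eC (-((r+1)*τ)) * C (r+2) = C r := hs
      rw [← hs']
      linear_combination (-C (r+2)) * e
    · intro z
      simp only [h1]
      congr 1
      have : -((r:ℂ)*(z+1)) = -(r*z) + ((-r : ℤ):ℂ) := by push_cast; ring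
      rw [this, eC_add_int]
  have hE : ∀ n : ℤ, C (2*n) = C 0 * eC (n^2*τ) := by
    intro n
    induction n using Int.induction_on with
    | zero => simp [eC_zero]
    | succ i ih =>
      have := hrec (2*i)
      rw [ih] at this
      rw [show 2*((i:ℤ)+1) = 2*i+2 by ring, this, mul_left_comm, ← eC_add]
      congr 2; push_cast; ring
    | pred i ih =>
      have := hrec (2*(-i-1))
      rw [show 2*(-(i:ℤ)-1)+2 = 2*(-i) by ring, ih] at this
      have e := eC_neg_mul (((2*(-i-1):ℤ):ℂ)*τ+τ)
      have e2 : eC (((-(i:ℤ)-1 : ℤ):ℂ)^2*τ) = eC (-(((2*(-i-1):ℤ):ℂ)*τ+τ)) * eC (((-(i:ℤ):ℤ):ℂ)^2*τ) := by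
        rw [← eC_add]; congr 1; push_cast; ring
      rw [e2]
      have e3 : ((((2 * (-(i:ℤ) - 1):ℤ)):ℂ) + 1)*τ = (((2*(-i-1):ℤ):ℂ)*τ+τ) := by push_cast; ring
      rw [e3] at this
      linear_combination (-eC (-(((2*(-i-1):ℤ):ℂ)*τ+τ))) * this - C (2*(-i-1)) * e
  have hO : ∀ n : ℤ, C (2*n+1) = (C 1 * eC (-(τ/4))) * eC ((2*n+1)^2/4*τ) := by
    intro n
    induction n using Int.induction_on with
    | zero =>
      simp only [mul_assoc]
      rw [← eC_add]
      have : -(τ/4) + (2*((0:ℤ):ℂ)+1)^2/4*τ = 0 := by push_cast; ring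
      rw [this, eC_zero]; simp
    | succ i ih =>
      have := hrec (2*i+1)
      rw [ih] at this
      rw [show 2*((i:ℤ)+1)+1 = 2*i+1+2 by ring, this, mul_left_comm, ← eC_add]
      congr 2; push_cast; ring
    | pred i ih =>
      have := hrec (2*(-i-1)+1)
      rw [show 2*(-(i:ℤ)-1)+1+2 = 2*(-i)+1 by ring, ih] at this
      have e := eC_neg_mul (((2*(-i-1)+1:ℤ):ℂ)*τ+τ)
      have e2 : eC ((2*((-(i:ℤ)-1 : ℤ):ℂ)+1)^2/4*τ) = eC (-(((2*(-i-1)+1:ℤ):ℂ)*τ+τ)) * eC ((2*((-(i:ℤ):ℤ):ℂ)+1)^2/4*τ) := by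
        rw [← eC_add]; congr 1; push_cast; ring
      rw [e2]
      have e3 : ((((2 * (-(i:ℤ) - 1)+1:ℤ)):ℂ) + 1)*τ = (((2*(-i-1)+1:ℤ):ℂ)*τ+τ) := by push_cast; ring
      rw [e3] at this
      linear_combination (-eC (-(((2*(-i-1)+1:ℤ):ℂ)*τ+τ))) * this - C (2*(-i-1)+1) * e
  refine ⟨C 0, C 1 * eC (-(τ/4)), ?_⟩
  have hsum : ∀ z : ℂ, HasSum (fun r : ℤ => C r * eC (r * z)) (C 0 * t0 τ z + C 1 * eC (-(τ/4)) * t1 τ z) := by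
    intro z
    refine hasSum_int_even_add_odd (hasSum_congr' ((t0_hasSum h z).mul_left (C 0)) fun n => ?_)
      (hasSum_congr' ((t1_hasSum h z).mul_left (C 1 * eC (-(τ/4)))) fun n => ?_)
    · rw [hE, mul_assoc, ← eC_add]; congr 2; push_cast; ring
    · rw [hO, mul_assoc _ _ (eC _), ← eC_add]; congr 2; push_cast; ring
  have hper : Function.Periodic (fun x : ℝ => g x) 1 := by
    intro x
    have := h1 x
    simpa using this
  have : Fact ((0:ℝ) < 1) := ⟨one_pos⟩
  let G : C(AddCircle (1:ℝ), ℂ) := ⟨hper.lift, by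
    have hc : Continuous (fun x : ℝ => g x) := hg.continuous.comp (by fun_prop)
    exact continuous_coinduced_dom.mpr hc⟩
  have hcoef : ∀ r, fourierCoeff G r = C r := by
    intro r
    rw [fourierCoeff_eq_intervalIntegral _ _ 0, hC]
    simp only [one_div, inv_one, one_smul, zero_add]
    refine intervalIntegral.integral_congr ?_
    intro x _
    simp only [fourier_coe_apply, smul_eq_mul]
    rw [mul_comm]
    congr 1
    rw [eC]; congr 1; push_cast; ring
  have hreal : ∀ x : ℝ, g x = C 0 * t0 τ x + C 1 * eC (-(τ/4)) * t1 τ x := by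
    intro x
    have hs : Summable (fourierCoeff G) := by
      have := (hsum 0).summable
      simp only [mul_zero, eC_zero, mul_one] at this
      exact this.congr (fun r => (hcoef r).symm)
    have h3 := has_pointwise_sum_fourier_series_of_summable hs (x : AddCircle (1:ℝ))
    refine HasSum.unique (a₁ := g x) (hasSum_congr' h3 ?_) (hsum x)
    intro r
    rw [hcoef]
    simp only [fourier_coe_apply, smul_eq_mul, eC]
    congr 2
    push_cast; ring
  have hR : Differentiable ℂ (fun z => C 0 * t0 τ z + C 1 * eC (-(τ/4)) * t1 τ z) :=
    ((t0_entire h).const_mul _).add ((t1_entire h).const_mul _)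
  have hfr : ∃ᶠ z in nhdsWithin (0:ℂ) {0}ᶜ, g z = C 0 * t0 τ z + C 1 * eC (-(τ/4)) * t1 τ z := by
    have ht : Filter.Tendsto (fun x : ℝ => (x:ℂ)) (nhdsWithin 0 {0}ᶜ) (nhdsWithin (0:ℂ) {0}ᶜ) := by
      refine tendsto_nhdsWithin_iff.mpr ⟨?_, ?_⟩
      · have : Filter.Tendsto (fun x : ℝ => (x:ℂ)) (nhds 0) (nhds ((0:ℝ):ℂ)) := Complex.continuous_ofReal.tendsto 0
        rw [ofReal_zero] at this
        exact this.mono_left nhdsWithin_le_nhds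
      · filter_upwards [self_mem_nhdsWithin] with x hx
        simpa using hx
    refine ht.frequently ?_
    exact (Filter.Eventually.of_forall hreal).frequently
  have := AnalyticOnNhd.eq_of_frequently_eq (f := g) (z₀ := 0)
    (fun z _ => hg.analyticAt z) (fun z _ => hR.analyticAt z) hfr
  exact fun z => congrFun this z

/-- the theta function vanishing at 0 and 1/2 is zero -/
lemma theta1d_zero {τ : ℂ} (h : UHP τ) (g : ℂ → ℂ) (hg : Differentiable ℂ g) (h1 : ∀ z, g (z+1) = g z)
    (hτ : ∀ z, g (z+τ) = eC (-τ-2*z) * g z) (h0 : g 0 = 0) (h2 : g (1/2) = 0) : ∀ z, g z = 0 := by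
  obtain ⟨A, B, hAB⟩ := theta1d h g hg h1 hτ
  have a0 := hAB 0
  have a1 := hAB (0+1/2)
  rw [t0_half h, t1_half h] at a1
  rw [zero_add, h2] at a1
  rw [h0] at a0
  change 0 = A * X τ + B * Y τ at a0
  change 0 = A * X τ + B * -Y τ at a1
  have hA : A = 0 := by
    have : A * X τ = 0 := by linear_combination (-a0-a1)/2
    exact (mul_eq_zero.mp this).resolve_right (X_ne h)
  have hB : B = 0 := by
    have : B * Y τ = 0 := by linear_combination (-a0+a1)/2
    exact (mul_eq_zero.mp this).resolve_right (Y_ne h)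
  intro z
  rw [hAB, hA, hB]; ring

/-- `φ` in the coordinates `u, v`. -/
def uv (φ : ℂ → ℂ → ℂ → ℂ) (τ u v : ℂ) : ℂ := φ τ (u - I*v) (u + I*v)

lemma isOpen_uhp3 : IsOpen {p : ℂ × ℂ × ℂ | UHP p.1} :=
  isOpen_lt continuous_const (Complex.continuous_im.comp continuous_fst)

lemma isOpen_uhp2 : IsOpen {p : ℂ × ℂ | UHP p.1} :=
  isOpen_lt continuous_const (Complex.continuous_im.comp continuous_fst)

section
variable {k : ℕ} {φ : ℂ → ℂ → ℂ → ℂ}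

lemma hjf_u_diff (H : IsHJF k 1 φ) {τ : ℂ} (h : UHP τ) (v : ℂ) :
    Differentiable ℂ (fun u => uv φ τ u v) := by
  intro u
  have h1 : DifferentiableAt ℂ (fun p : ℂ × ℂ × ℂ => φ p.1 p.2.1 p.2.2) (τ, u - I*v, u+I*v) :=
    H.holo.differentiableAt (isOpen_uhp3.mem_nhds h)
  have h2 : DifferentiableAt ℂ (fun u : ℂ => ((τ, u - I*v, u+I*v) : ℂ × ℂ × ℂ)) u := by fun_prop
  exact DifferentiableAt.comp (f := fun u : ℂ => ((τ, u - I*v, u+I*v) : ℂ × ℂ × ℂ)) u h1 h2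

lemma hjf_v_diff (H : IsHJF k 1 φ) {τ : ℂ} (h : UHP τ) (u : ℂ) :
    Differentiable ℂ (fun v => uv φ τ u v) := by
  intro v
  have h1 : DifferentiableAt ℂ (fun p : ℂ × ℂ × ℂ => φ p.1 p.2.1 p.2.2) (τ, u - I*v, u+I*v) :=
    H.holo.differentiableAt (isOpen_uhp3.mem_nhds h)
  have h2 : DifferentiableAt ℂ (fun v : ℂ => ((τ, u - I*v, u+I*v) : ℂ × ℂ × ℂ)) v := by fun_prop
  exact DifferentiableAt.comp (f := fun v : ℂ => ((τ, u - I*v, u+I*v) : ℂ × ℂ × ℂ)) v h1 h2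

lemma hjf_ellip (H : IsHJF k 1 φ) {τ : ℂ} (h : UHP τ) (p q a b : ℤ) (u v : ℂ) :
    uv φ τ (u+p*τ+a) (v+q*τ+b) = eC (-(p^2*τ+2*p*u) - (q^2*τ+2*q*v)) * uv φ τ u v := by
  have := H.ellip p (-q) a (-b) τ (u-I*v) (u+I*v) h
  unfold uv
  convert this using 2
  · push_cast; ring
  · push_cast; ring
  · congr 1; push_cast; ring_nf; simp only [I_sq]; ring

lemma hjf_swap (hk4 : k % 4 = 2) (H : IsHJF k 1 φ) {τ : ℂ} (h : UHP τ) (u v : ℂ) :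
    uv φ τ v (-u) = - uv φ τ u v := by
  have := H.transf I (by simp) 1 τ (u-I*v) (u+I*v) h
  have hk : I^k = -1 := by
    rw [← Nat.div_add_mod k 4, hk4, pow_add, pow_mul, I_pow_four]; simp
  simp [Ma, Mb, Mc, Md, eC_zero, hk] at this
  unfold uv
  rw [← this]
  congr 1
  · ring_nf; simp only [I_sq]; ring
  · ring_nf; simp only [I_sq]; ring

end

theorem part1 (k : ℕ) (hk4 : k % 4 = 2) (φ ψ : ℂ → ℂ → ℂ → ℂ) (hφ : IsHJF k 1 φ) (hψ : IsHJF k 1 ψ)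
    (hz : ∀ τ z : ℂ, UHP τ → φ τ z z = ψ τ z z) (τ z₁ z₂ : ℂ) (h : UHP τ) : φ τ z₁ z₂ = ψ τ z₁ z₂ := by
  set D : ℂ → ℂ → ℂ := fun u v => uv φ τ u v - uv ψ τ u v with hD
  have ell : ∀ (p q a b : ℤ) (u v : ℂ),
      D (u+p*τ+a) (v+q*τ+b) = eC (-(p^2*τ+2*p*u) - (q^2*τ+2*q*v)) * D u v := by
    intro p q a b u v
    simp only [hD, hjf_ellip hφ h, hjf_ellip hψ h]; ring
  have u1 : ∀ u v, D (u+1) v = D u v := by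
    intro u v
    simpa [eC_zero] using ell 0 0 1 0 u v
  have v1 : ∀ u v, D u (v+1) = D u v := by
    intro u v
    simpa [eC_zero] using ell 0 0 0 1 u v
  have ut : ∀ u v, D (u+τ) v = eC (-τ-2*u) * D u v := by
    intro u v
    have := ell 1 0 0 0 u v
    simp at this
    rw [this]; congr 2; ring
  have vt : ∀ u v, D u (v+τ) = eC (-τ-2*v) * D u v := by
    intro u v
    have := ell 0 1 0 0 u v
    simp at this
    rw [this]; congr 2; ring
  have sw : ∀ u v, D v (-u) = - D u v := by
    intro u v
    simp only [hD, hjf_swap hk4 hφ h, hjf_swap hk4 hψ h]; ring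
  have du : ∀ v, Differentiable ℂ (fun u => D u v) := fun v => (hjf_u_diff hφ h v).sub (hjf_u_diff hψ h v)
  have dv : ∀ u, Differentiable ℂ (fun v => D u v) := fun u => (hjf_v_diff hφ h u).sub (hjf_v_diff hψ h u)
  have z0 : ∀ u, D u 0 = 0 := by
    intro u
    simp [hD, uv, hz τ u h]
  have z1 : ∀ v, D 0 v = 0 := by
    intro v
    have := sw (-v) 0
    rw [neg_neg, z0, neg_zero] at this
    exact this
  have z2 : D (1/2) (1/2) = 0 := by
    have e1 := sw (1/2) (1/2)
    have e2 := v1 (1/2) (-(1/2))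
    rw [e1, show -(1/2:ℂ)+1 = 1/2 by ring] at e2
    linear_combination e2/2
  have z3 : ∀ v, D (1/2) v = 0 :=
    theta1d_zero h (fun v => D (1/2) v) (dv _) (v1 _) (vt _) (z0 _) z2
  have z4 : ∀ v u, D u v = 0 := fun v =>
    theta1d_zero h (fun u => D u v) (du _) (fun u => u1 u v) (fun u => ut u v) (z1 v) (z3 v)
  have := z4 (I*(z₁-z₂)/2) ((z₁+z₂)/2)
  have a1 : (z₁+z₂)/2 - I*(I*(z₁-z₂)/2) = z₁ := by ring_nf; simp only [I_sq]; ring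
  have a2 : (z₁+z₂)/2 + I*(I*(z₁-z₂)/2) = z₂ := by ring_nf; simp only [I_sq]; ring
  simp only [hD, uv, a1, a2] at this
  exact sub_eq_zero.mp this

open Filter Topology in
lemma odd_expand (g : ℂ → ℂ) (hg : DifferentiableOn ℂ g {τ | UHP τ})
    (hT : ∀ τ, UHP τ → g (τ+1) = -I * g τ) (hb : g =O[iinf] (fun _ => (1:ℝ))) :
    ∃ b : ℕ → ℂ, b 0 = 0 ∧ ∀ τ, UHP τ → HasSum (fun n : ℕ => b n * eC (n*τ)) (g τ * eC (τ/4)) := by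
  have hl : Tendsto (fun τ : ℂ => eC (τ/4)) iinf (𝓝 0) := by
    refine (eC_lim (c := 1/4) (by norm_num)).congr fun τ => ?_
    congr 1; push_cast; ring
  have hlim : Tendsto (fun τ => g τ * eC (τ/4)) iinf (𝓝 0) := by
    have h1 : (fun τ : ℂ => eC (τ/4)) =o[iinf] (fun _ => (1:ℝ)) := (Asymptotics.isLittleO_one_iff ℝ).mpr hl
    have := hb.mul_isLittleO h1
    simp only [mul_one] at this
    exact (Asymptotics.isLittleO_one_iff ℝ).mp this
  obtain ⟨b, hb1, hb2⟩ := per_expand (fun τ => g τ * eC (τ/4)) (hg.mul (eC_diff.comp (by fun_prop)).differentiableOn)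
    (fun τ h => by
      have : (τ+1)/4 = τ/4 + 1/4 := by ring
      rw [hT τ h, this, eC_add, eC_quarter]
      linear_combination (-g τ * eC (τ/4)) * I_sq) (hlim.isBigO_one ℝ)
  exact ⟨b, tendsto_nhds_unique hb2 hlim, hb1⟩

lemma four_ext {ι κ : Type*} {i : ι → κ} (hi : Function.Injective i) {a : ι → ℂ} {E : κ → ℂ} {s : ℂ}
    (h : HasSum (fun p => a p * E (i p)) s) : HasSum (fun q => Function.extend i a 0 q * E q) s := by
  refine (hi.hasSum_iff ?_).mp (hasSum_congr' h fun p => ?_)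
  · intro x hx
    rw [Function.extend_apply' _ _ _ (by simpa using hx)]; simp
  · simp [hi.extend_apply]

lemma ext_zero {ι κ : Type*} {i : ι → κ} (hi : Function.Injective i) {a : ι → ℂ} (P : κ → Prop)
    (h : ∀ p, P (i p) → a p = 0) (q : κ) (hq : P q) : Function.extend i a 0 q = 0 := by
  by_cases hx : ∃ p, i p = q
  · obtain ⟨p, rfl⟩ := hx
    rw [hi.extend_apply, h p hq]
  · rw [Function.extend_apply' _ _ _ hx]; rfl

lemma hs_mul {ι κ : Type*} {f : ι → ℂ} {g : κ → ℂ} {s t : ℂ} (hf : HasSum f s) (hg : HasSum g t) :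
    HasSum (fun p : ι × κ => f p.1 * g p.2) (s * t) :=
  hf.mul hg (summable_mul_of_summable_norm hf.summable.norm hg.summable.norm)

lemma toNat_c {m : ℕ} {x : ℤ} (hx : 0 ≤ x) : ((m + x.toNat : ℕ) : ℂ) = m + (x:ℂ) := by
  have : ((x.toNat : ℤ) : ℂ) = x := by rw [Int.toNat_of_nonneg hx]
  rw [← this, Nat.cast_add, Int.cast_natCast]

lemma nn_nn (n : ℤ) : 0 ≤ n^2+n := by
  rcases le_or_gt 0 n with h | h
  · positivity
  · nlinarith

theorem jf_of (k : ℕ) (h0 h1 : ℂ → ℂ) (d0 : DifferentiableOn ℂ h0 {τ | UHP τ}) (d1 : DifferentiableOn ℂ h1 {τ | UHP τ})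
    (T0 : ∀ τ, UHP τ → h0 (τ+1) = h0 τ) (T1 : ∀ τ, UHP τ → h1 (τ+1) = -I * h1 τ)
    (b0 : h0 =O[iinf] (fun _ => (1:ℝ))) (b1 : h1 =O[iinf] (fun _ => (1:ℝ)))
    (S0 : ∀ τ, UHP τ → sS τ * (h0 (-1/τ) + h1 (-1/τ)) = τ^k * h0 τ)
    (S1 : ∀ τ, UHP τ → sS τ * (h0 (-1/τ) - h1 (-1/τ)) = τ^k * h1 τ) :
    IsJF k 1 (fun τ z => h0 τ * t0 τ z + h1 τ * t1 τ z) := by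
  constructor
  · rintro ⟨τ, z⟩ h
    have hm : {τ : ℂ | UHP τ} ∈ nhds τ := (isOpen_lt continuous_const Complex.continuous_im).mem_nhds h
    have e0 : DifferentiableAt ℂ (fun p : ℂ × ℂ => h0 p.1) (τ,z) :=
      DifferentiableAt.comp (f := Prod.fst) (τ,z) (d0.differentiableAt hm) differentiableAt_fst
    have e1 : DifferentiableAt ℂ (fun p : ℂ × ℂ => h1 p.1) (τ,z) :=
      DifferentiableAt.comp (f := Prod.fst) (τ,z) (d1.differentiableAt hm) differentiableAt_fst
    exact ((e0.mul (t0_diff h z)).add (e1.mul (t1_diff h z))).differentiableWithinAt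
  · intro M τ z h
    have := sl2_ext (E := ℂ) (fun z => z^2) (fun c z => by simp [mul_pow]) (fun τ z => h0 τ * t0 τ z + h1 τ * t1 τ z) k
      (fun τ z h => by
        simp only [T0 τ h, T1 τ h, t0_T h, t1_T h]
        linear_combination (-h1 τ * t1 τ z) * I_sq)
      (fun τ z h => by
        have e : (τ⁻¹ • z : ℂ) = z/τ := by rw [smul_eq_mul]; ring
        simp only [e, t0_S h, t1_S h]
        linear_combination (eC (z^2/τ) * t0 τ z) * S0 τ h + (eC (z^2/τ) * t1 τ z) * S1 τ h) M τ z h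
    have e : ((Mc M * τ + Md M)⁻¹ • z : ℂ) = z/(Mc M * τ + Md M) := by rw [smul_eq_mul]; ring
    rw [e] at this
    simp only [Nat.cast_one, one_mul]
    exact this
  · intro p q τ z h
    simp only [t0_ellip h, t1_ellip h, Nat.cast_one, neg_mul, one_mul]
    ring
  · obtain ⟨a, ha, -⟩ := per_expand h0 d0 T0 b0
    obtain ⟨b, hb0, hb⟩ := odd_expand h1 d1 T1 b1
    let i0 : ℕ × ℤ → ℕ × ℤ := fun p => (p.1 + (p.2^2).toNat, 2*p.2)
    let i1 : ℕ × ℤ → ℕ × ℤ := fun p => (p.1 + (p.2^2+p.2).toNat, 2*p.2+1)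
    have j0 : Function.Injective i0 := by
      rintro ⟨m, n⟩ ⟨m', n'⟩ e
      simp only [i0, Prod.mk.injEq] at e
      obtain ⟨e1, e2⟩ := e
      have : n = n' := by omega
      subst this
      simpa using e1
    have j1 : Function.Injective i1 := by
      rintro ⟨m, n⟩ ⟨m', n'⟩ e
      simp only [i1, Prod.mk.injEq] at e
      obtain ⟨e1, e2⟩ := e
      have : n = n' := by omega
      subst this
      simpa using e1
    refine ⟨fun n r => Function.extend i0 (fun p => a p.1) 0 (n,r) + Function.extend i1 (fun p => b p.1) 0 (n,r), ?_, ?_⟩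
    · intro n r hr
      have z0 := ext_zero j0 (a := fun p => a p.1) (fun q : ℕ × ℤ => 4 * (q.1:ℤ) * ((1:ℕ):ℤ) < q.2^2) ?_ (n,r) hr
      have z1 := ext_zero j1 (a := fun p => b p.1) (fun q : ℕ × ℤ => 4 * (q.1:ℤ) * ((1:ℕ):ℤ) < q.2^2) ?_ (n,r) hr
      · simp only [z0, z1, add_zero]
      · rintro ⟨m, n⟩ hp
        simp only [i1] at hp
        push_cast at hp
        rw [Int.toNat_of_nonneg (nn_nn n)] at hp
        have : m = 0 := by
          by_contra hm
          have : (1:ℤ) ≤ m := by omega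
          nlinarith
        simp [this, hb0]
      · rintro ⟨m, n⟩ hp
        simp only [i0] at hp
        push_cast at hp
        rw [Int.toNat_of_nonneg (sq_nonneg n)] at hp
        nlinarith
    · intro τ z h
      have s0 := hs_mul (ha τ h) (t0_hasSum h z)
      have s1 := hs_mul ((hb τ h).mul_right (eC (-(τ/4)))) (t1_hasSum h z)
      have e1 : h1 τ * eC (τ/4) * eC (-(τ/4)) = h1 τ := by
        rw [mul_assoc, mul_comm (eC _), eC_neg_mul, mul_one]
      rw [e1] at s1
      have s0' := four_ext (E := fun q : ℕ × ℤ => eC (q.1 * τ + q.2 * z)) j0 (a := fun p => a p.1)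
        (hasSum_congr' s0 fun p => by
          simp only [i0]
          rw [toNat_c (sq_nonneg _), mul_assoc, ← eC_add]
          congr 2; push_cast; ring)
      have s1' := four_ext (E := fun q : ℕ × ℤ => eC (q.1 * τ + q.2 * z)) j1 (a := fun p => b p.1)
        (hasSum_congr' s1 fun p => by
          simp only [i1]
          rw [toNat_c (nn_nn _), mul_assoc, mul_assoc, ← eC_add, ← eC_add]
          congr 2; push_cast; ring)
      exact hasSum_congr' (s0'.add s1') fun p => by ring

def hjf (g : ℂ → ℂ) (τ z₁ z₂ : ℂ) : ℂ :=
  g τ * (t1 τ ((z₁+z₂)/2) * t0 τ (I*(z₁-z₂)/2) - t0 τ ((z₁+z₂)/2) * t1 τ (I*(z₁-z₂)/2))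

lemma hjf_I (g : ℂ → ℂ) {τ : ℂ} (h : UHP τ) (z₁ z₂ : ℂ) : hjf g τ (I*z₁) (-I*z₂) = - hjf g τ z₁ z₂ := by
  have e1 : (I*z₁ + -I*z₂)/2 = I*(z₁-z₂)/2 := by ring
  have e2 : I*(I*z₁ - -I*z₂)/2 = -((z₁+z₂)/2) := by linear_combination ((z₁+z₂)/2) * I_sq
  simp only [hjf, e1, e2, t0_neg, t1_neg h]
  ring

theorem hjf_of (k : ℕ) (hk4 : k % 4 = 2) (g : ℂ → ℂ) (d : DifferentiableOn ℂ g {τ | UHP τ})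
    (T : ∀ τ, UHP τ → g (τ+1) = -I * g τ) (b : g =O[iinf] (fun _ => (1:ℝ)))
    (S : ∀ τ, UHP τ → I * τ * g (-1/τ) = τ^k * g τ) :
    IsHJF k 1 (hjf g) := by
  have hk : I^k = -1 := by
    rw [← Nat.div_add_mod k 4, hk4, pow_add, pow_mul, I_pow_four]; simp
  have hk2 : (-1:ℂ)^k = 1 := by
    rw [← Nat.div_add_mod k 4, hk4, pow_add, pow_mul]; norm_num
  have hk3 : (-I)^k = -1 := by
    rw [neg_eq_neg_one_mul, mul_pow, hk, hk2]; ring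
  constructor
  · rintro ⟨τ, z₁, z₂⟩ h
    have hm : {τ : ℂ | UHP τ} ∈ nhds τ := (isOpen_lt continuous_const Complex.continuous_im).mem_nhds h
    have e : DifferentiableAt ℂ (fun p : ℂ × ℂ × ℂ => g p.1) (τ,z₁,z₂) :=
      DifferentiableAt.comp (f := Prod.fst) (τ,z₁,z₂) (d.differentiableAt hm) differentiableAt_fst
    have f1 : DifferentiableAt ℂ (fun p : ℂ × ℂ × ℂ => ((p.1, (p.2.1+p.2.2)/2) : ℂ × ℂ)) (τ,z₁,z₂) := by fun_prop
    have f2 : DifferentiableAt ℂ (fun p : ℂ × ℂ × ℂ => ((p.1, I*(p.2.1-p.2.2)/2) : ℂ × ℂ)) (τ,z₁,z₂) := by fun_prop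
    have a1 := DifferentiableAt.comp (τ,z₁,z₂) (t0_diff h ((z₁+z₂)/2)) f1
    have a2 := DifferentiableAt.comp (τ,z₁,z₂) (t0_diff h (I*(z₁-z₂)/2)) f2
    have a3 := DifferentiableAt.comp (τ,z₁,z₂) (t1_diff h ((z₁+z₂)/2)) f1
    have a4 := DifferentiableAt.comp (τ,z₁,z₂) (t1_diff h (I*(z₁-z₂)/2)) f2
    exact (e.mul ((a3.mul a2).sub (a1.mul a4))).differentiableWithinAt
  · intro ε hε M τ z₁ z₂ h
    have key := sl2_ext (E := ℂ × ℂ) (fun z => z.1*z.2) (fun c z => by simp; ring) (fun τ z => hjf g τ z.1 z.2) k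
      (fun τ z h => by
        simp only [hjf, T τ h, t0_T h, t1_T h]
        linear_combination (-g τ * (t1 τ ((z.1+z.2)/2) * t0 τ (I*(z.1-z.2)/2) - t0 τ ((z.1+z.2)/2) * t1 τ (I*(z.1-z.2)/2))) * I_sq)
      (fun τ z h => by
        have e1 : (τ⁻¹ * z.1 + τ⁻¹ * z.2)/2 = ((z.1+z.2)/2)/τ := by ring
        have e2 : I*(τ⁻¹ * z.1 - τ⁻¹ * z.2)/2 = (I*(z.1-z.2)/2)/τ := by ring
        simp only [hjf, Prod.smul_fst, Prod.smul_snd, smul_eq_mul, e1, e2, t0_S h, t1_S h]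
        have e3 : eC (z.1*z.2/τ) = eC (((z.1+z.2)/2)^2/τ) * eC ((I*(z.1-z.2)/2)^2/τ) := by
          rw [← eC_add]; congr 1
          linear_combination (-(z.1-z.2)^2/(4*τ)) * I_sq
        rw [e3]
        have s := sS_sq τ
        have S' := S τ h
        generalize eC (((z.1+z.2)/2)^2/τ) = A at *
        generalize eC ((I*(z.1-z.2)/2)^2/τ) = B at *
        generalize t0 τ ((z.1+z.2)/2) = x0 at *
        generalize t1 τ ((z.1+z.2)/2) = x1 at *
        generalize t0 τ (I*(z.1-z.2)/2) = y0 at *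
        generalize t1 τ (I*(z.1-z.2)/2) = y1 at *
        linear_combination (-2 * g (-1/τ) * A * B * (x1*y0-x0*y1)) * s + (A * B * (x1*y0-x0*y1)) * S') M τ (ε*z₁, (starRingEnd ℂ) ε*z₂) h
    have u : ε * (starRingEnd ℂ) ε = 1 ∧ hjf g τ (ε*z₁) ((starRingEnd ℂ) ε*z₂) = ε^k * hjf g τ z₁ z₂ := by
      have h1 := hjf_I g h z₁ z₂
      have h2 := hjf_I g h (I*z₁) (-I*z₂)
      have h3 := hjf_I g h (-I*z₁) (I*z₂)
      have i1 : ∀ z, I * (I*z) = -z := fun z => by linear_combination z * I_sq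
      have i2 : ∀ z, I * (-I*z) = z := fun z => by linear_combination -z * I_sq
      have i3 : ∀ z, -I * (-I*z) = -z := fun z => by linear_combination z * I_sq
      have i4 : ∀ z, -I * (I*z) = z := fun z => by linear_combination -z * I_sq
      rw [i1, i3, h1] at h2
      rw [i2, i4] at h3
      rcases hε with rfl | rfl | rfl | rfl
      · simp
      · simp [hk2, h2]
      · simp only [conj_I, h1, hk]
        constructor
        · linear_combination -I_sq
        · ring
      · simp only [map_neg, conj_I, neg_neg, hk3]
        constructor
        · linear_combination -I_sq
        · rw [h3]; ring
    simp only [Prod.smul_fst, Prod.smul_snd, smul_eq_mul, inv_mul_eq_div] at key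
    rw [key, u.2]
    have e : Mc M * (ε * z₁ * ((starRingEnd ℂ) ε * z₂)) = ((1:ℕ):ℂ) * Mc M * z₁ * z₂ := by
      push_cast
      linear_combination (Mc M * z₁ * z₂) * u.1
    rw [e]; ring
  · intro p q u v τ z₁ z₂ h
    have e1 : (z₁ + ((p : ℂ) + (q : ℂ) * I) * τ + ((u : ℂ) + (v : ℂ) * I)
       + (z₂ + ((p : ℂ) - (q : ℂ) * I) * τ + ((u : ℂ) - (v : ℂ) * I)))/2 = (z₁+z₂)/2 + p*τ+u := by ring
    have e2 : I*(z₁ + ((p : ℂ) + (q : ℂ) * I) * τ + ((u : ℂ) + (v : ℂ) * I)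
       - (z₂ + ((p : ℂ) - (q : ℂ) * I) * τ + ((u : ℂ) - (v : ℂ) * I)))/2 = I*(z₁-z₂)/2 + ((-q:ℤ):ℂ)*τ+((-v:ℤ):ℂ) := by
      push_cast
      linear_combination (q*τ+v)*I_sq
    simp only [hjf, e1, e2, t0_ellip h, t1_ellip h]
    have e3 : eC (-((1:ℕ) : ℂ) * (((p : ℂ) ^ 2 + (q : ℂ) ^ 2) * τ
          + ((p : ℂ) - (q : ℂ) * I) * z₁ + ((p : ℂ) + (q : ℂ) * I) * z₂)) =
        eC (-((p : ℂ) ^ 2 * τ + 2 * p * ((z₁+z₂)/2))) * eC (-((((-q:ℤ)):ℂ) ^ 2 * τ + 2 * ((-q:ℤ):ℂ) * (I*(z₁-z₂)/2))) := by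
      rw [← eC_add]; congr 1; push_cast; ring
    rw [e3]; ring
  · obtain ⟨b, hb0, hb⟩ := odd_expand g d T b
    let i0 : ℕ × ℤ × ℤ → ℕ × ℤ × ℤ := fun p => (p.1 + (p.2.1^2 + (p.2.2^2+p.2.2)).toNat, 2*p.2.1, 2*p.2.2+1)
    let i1 : ℕ × ℤ × ℤ → ℕ × ℤ × ℤ := fun p => (p.1 + (p.2.2^2 + (p.2.1^2+p.2.1)).toNat, 2*p.2.1+1, 2*p.2.2)
    have j0 : Function.Injective i0 := by
      rintro ⟨m, n, l⟩ ⟨m', n', l'⟩ e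
      simp only [i0, Prod.mk.injEq] at e
      obtain ⟨e1, e2, e3⟩ := e
      have : n = n' := by omega
      subst this
      have : l = l' := by omega
      subst this
      simpa using e1
    have j1 : Function.Injective i1 := by
      rintro ⟨m, n, l⟩ ⟨m', n', l'⟩ e
      simp only [i1, Prod.mk.injEq] at e
      obtain ⟨e1, e2, e3⟩ := e
      have : n = n' := by omega
      subst this
      have : l = l' := by omega
      subst this
      simpa using e1
    have pos : ∀ n l : ℤ, 0 ≤ n^2 + (l^2+l) := fun n l => add_nonneg (sq_nonneg n) (nn_nn l)
    refine ⟨fun n r s => Function.extend i1 (fun p => b p.1) 0 (n,r,s) - Function.extend i0 (fun p => b p.1) 0 (n,r,s), ?_, ?_⟩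
    · intro n r s hr
      have z0 := ext_zero j0 (a := fun p => b p.1) (fun q : ℕ × ℤ × ℤ => 4 * (q.1:ℤ) * ((1:ℕ):ℤ) < q.2.1^2 + q.2.2^2) ?_ (n,r,s) hr
      have z1 := ext_zero j1 (a := fun p => b p.1) (fun q : ℕ × ℤ × ℤ => 4 * (q.1:ℤ) * ((1:ℕ):ℤ) < q.2.1^2 + q.2.2^2) ?_ (n,r,s) hr
      · simp only [z0, z1, sub_zero]
      · rintro ⟨m, n, l⟩ hp
        simp only [i1] at hp
        push_cast at hp
        rw [Int.toNat_of_nonneg (pos l n)] at hp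
        have : m = 0 := by
          by_contra hm
          have : (1:ℤ) ≤ m := by omega
          nlinarith
        simp [this, hb0]
      · rintro ⟨m, n, l⟩ hp
        simp only [i0] at hp
        push_cast at hp
        rw [Int.toNat_of_nonneg (pos n l)] at hp
        have : m = 0 := by
          by_contra hm
          have : (1:ℤ) ≤ m := by omega
          nlinarith
        simp [this, hb0]
    · intro τ z₁ z₂ h
      have s := (hb τ h).mul_right (eC (-(τ/4)))
      have e1 : g τ * eC (τ/4) * eC (-(τ/4)) = g τ := by
        rw [mul_assoc, mul_comm (eC _), eC_neg_mul, mul_one]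
      rw [e1] at s
      have s0 := hs_mul s (hs_mul (t0_hasSum h ((z₁+z₂)/2)) (t1_hasSum h (I*(z₁-z₂)/2)))
      have s1 := hs_mul s (hs_mul (t1_hasSum h ((z₁+z₂)/2)) (t0_hasSum h (I*(z₁-z₂)/2)))
      have s0' := four_ext (E := fun p : ℕ × ℤ × ℤ => 
          eC ((p.1 : ℂ) * τ + (((p.2.1 : ℂ) + (p.2.2 : ℂ) * Complex.I) / 2) * z₁
            + (((p.2.1 : ℂ) - (p.2.2 : ℂ) * Complex.I) / 2) * z₂)) j0 (a := fun p => b p.1)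
        (hasSum_congr' s0 fun p => by
          simp only [i0]
          rw [toNat_c (pos _ _)]
          simp only [mul_assoc, ← eC_add]
          congr 2; push_cast; ring)
      have s1' := four_ext (E := fun p : ℕ × ℤ × ℤ => 
          eC ((p.1 : ℂ) * τ + (((p.2.1 : ℂ) + (p.2.2 : ℂ) * Complex.I) / 2) * z₁
            + (((p.2.1 : ℂ) - (p.2.2 : ℂ) * Complex.I) / 2) * z₂)) j1 (a := fun p => b p.1)
        (hasSum_congr' s1 fun p => by
          simp only [i1]
          rw [toNat_c (pos _ _)]
          simp only [mul_assoc, ← eC_add]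
          congr 2; push_cast; ring)
      have := s1'.sub s0'
      rw [← mul_sub] at this
      exact hasSum_congr' this fun p => by ring

lemma isMF_ML {k : ℕ} {f : ℂ → ℂ} (hf : IsMF k f) : ML k f := by
  refine ⟨hf.holo, ?_, ?_, ?_⟩
  · intro τ h
    have := hf.transf ModularGroup.T τ h
    simpa [Ma, Mb, Mc, Md, ModularGroup.T] using this
  · intro τ h
    have := hf.transf ModularGroup.S τ h
    simpa [Ma, Mb, Mc, Md, ModularGroup.S] using this
  · obtain ⟨A, B, h⟩ := hf.bounded
    refine Asymptotics.IsBigO.of_bound A ?_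
    have h0 : Filter.Tendsto Complex.im iinf Filter.atTop := Filter.tendsto_comap
    filter_upwards [h0.eventually (Filter.eventually_ge_atTop B)] with τ hτ
    simpa using h τ hτ

def P0 (τ : ℂ) : ℂ := X τ^11 - 22 * X τ^7 * Y τ^4 - 11 * X τ^3 * Y τ^8
def P1 (τ : ℂ) : ℂ := Y τ^11 - 22 * X τ^4 * Y τ^7 - 11 * X τ^8 * Y τ^3

lemma sS12 {τ} (h : UHP τ) : sS τ ^ 12 = -τ^6/64 := by
  have e : sS τ^12 = (sS τ^4)^3 := by ring
  rw [e, sS4 h]; ring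

theorem part3 (k : ℕ) (hk4 : k % 4 = 2) (f : ℂ → ℂ) (hf : IsMF k f) :
    ∃ ψ : ℂ → ℂ → ℂ, IsJF k 1 ψ ∧ ∀ τ : ℂ, UHP τ → ψ τ 0 = f τ := by
  obtain ⟨m, rfl⟩ : ∃ m, k = 4*m+2 := ⟨k/4, by omega⟩
  rcases ML.factor m f (isMF_ML hf) with ⟨j, G, hj, hG, hfG⟩ | h0
  · rw [hj]
    have hx := X_holo
    have hy := Y_holo
    have Pl0 : Filter.Tendsto P0 iinf (nhds 1) := by
      have := ((X_lim.pow 11).sub (((X_lim.pow 7).const_mul 22).mul (Y_lim.pow 4))).sub (((X_lim.pow 3).const_mul 11).mul (Y_lim.pow 8))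
      norm_num at this
      exact this
    have Pl1 : Filter.Tendsto P1 iinf (nhds 0) := by
      have := ((Y_lim.pow 11).sub (((X_lim.pow 4).const_mul 22).mul (Y_lim.pow 7))).sub (((X_lim.pow 8).const_mul 11).mul (Y_lim.pow 3))
      norm_num at this
      exact this
    refine ⟨_, jf_of (j+6) (fun τ => G τ * P0 τ) (fun τ => G τ * P1 τ) ?_ ?_ ?_ ?_ ?_ ?_ ?_ ?_, ?_⟩
    · refine hG.holo.mul ?_
      unfold P0; fun_prop
    · refine hG.holo.mul ?_
      unfold P1; fun_prop
    · intro τ h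
      have e : I^8 = 1 := by rw [show (8:ℕ)=4*2 from rfl, pow_mul, I4, one_pow]
      simp only [hG.T τ h, P0, X_T h, Y_T h, mul_pow, I4, e]
      ring
    · intro τ h
      have e : I^11 = -I := by rw [show (11:ℕ)=4*2+3 from rfl, pow_add, pow_mul, I4, one_pow, I_pow_three, one_mul]
      have e' : I^7 = -I := by rw [show (7:ℕ)=4+3 from rfl, pow_add, I4, I_pow_three, one_mul]
      simp only [hG.T τ h, P1, X_T h, Y_T h, mul_pow, e, e', I_pow_three]
      ring
    · simpa using hG.bd.mul (Pl0.isBigO_one ℝ)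
    · simpa using hG.bd.mul (Pl1.isBigO_one ℝ)
    · intro τ h
      have e := sS12 h
      simp only [hG.S τ h, P0, P1, X_S h, Y_S h]
      linear_combination (-64 * τ^j * G τ * (X τ^11 - 22 * X τ^7 * Y τ^4 - 11 * X τ^3 * Y τ^8)) * e
    · intro τ h
      have e := sS12 h
      simp only [hG.S τ h, P0, P1, X_S h, Y_S h]
      linear_combination (-64 * τ^j * G τ * (Y τ^11 - 22 * X τ^4 * Y τ^7 - 11 * X τ^8 * Y τ^3)) * e
    · intro τ h
      change G τ * P0 τ * X τ + G τ * P1 τ * Y τ = _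
      rw [hfG τ h]
      simp only [P0, P1, F6]; ring
  · refine ⟨_, jf_of _ (fun _ => 0) (fun _ => 0) ?_ ?_ ?_ ?_ ?_ ?_ ?_ ?_, ?_⟩
    · fun_prop
    · fun_prop
    · simp
    · simp
    · exact Asymptotics.isBigO_zero _ _
    · exact Asymptotics.isBigO_zero _ _
    · simp
    · simp
    · intro τ h; simp [h0 τ h]

lemma jf_bound {k : ℕ} {ψ : ℂ → ℂ → ℂ} (H : IsJF k 1 ψ) : ∃ c : ℂ, ∀ x : ℝ, ∃ C : ℝ, ∀ τ : ℂ, 1 ≤ τ.im →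
    ‖ψ τ x - c‖ ≤ C * ‖eC τ‖ := by
  obtain ⟨c, hc, hs⟩ := H.fourier
  refine ⟨c 0 0, fun x => ?_⟩
  have sI : Summable (fun p : ℕ × ℤ => ‖c p.1 p.2 * eC ((p.1 : ℂ) * I + (p.2 : ℂ) * x)‖) :=
    (hs I x (by simp [UHP])).summable.norm
  set b : ℕ × ℤ → ℝ := fun p => ‖c p.1 p.2 * eC ((p.1 : ℂ) * I + (p.2 : ℂ) * x)‖ with hb
  refine ⟨(∑' p, b p) * Real.exp (2*Real.pi), fun τ hτ => ?_⟩
  have h : UHP τ := lt_of_lt_of_le one_pos hτ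
  have s1 := (hs τ x h).sub (hasSum_ite_eq ((0,0) : ℕ × ℤ) (c 0 0))
  have s2 := (sI.hasSum.mul_right (Real.exp (2*Real.pi))).mul_right ‖eC τ‖
  rw [← s1.tsum_eq, ← s2.tsum_eq]
  refine tsum_of_norm_bounded s2.summable.hasSum ?_
  rintro ⟨n, r⟩
  rcases Nat.eq_zero_or_pos n with rfl | hn
  · by_cases hr : r = 0
    · subst hr
      simp [eC_zero]
      positivity
    · have : c 0 r = 0 := hc 0 r (by simpa using by positivity)
      simp [this, hr]
      positivity
  · have : ¬ ((n, r) = ((0,0) : ℕ × ℤ)) := by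
      intro e; simp at e; omega
    simp only [this, if_false, sub_zero, norm_mul, norm_eC, hb]
    rw [mul_assoc (_ * _), mul_assoc ‖c n r‖, ← Real.exp_add, ← Real.exp_add]
    gcongr
    simp
    have h1 : (1:ℝ) ≤ n := by exact_mod_cast hn
    nlinarith [Real.pi_pos, mul_nonneg Real.pi_pos.le (mul_nonneg (sub_nonneg.mpr h1) (sub_nonneg.mpr hτ))]

open Filter Topology in
theorem part2 (k : ℕ) (hk4 : k % 4 = 2) (ψ : ℂ → ℂ → ℂ) (H : IsJF k 1 ψ) :
      ((∀ τ : ℂ, UHP τ → ψ τ 0 = 0) ↔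
        ∃ φ : ℂ → ℂ → ℂ → ℂ, IsHJF k 1 φ ∧ ∀ τ z : ℂ, UHP τ → ψ τ z = φ τ z z) := by
  constructor
  swap
  · rintro ⟨φ, hφ, e⟩ τ h
    have := hjf_swap hk4 hφ h 0 0
    simp [uv] at this
    rw [e τ 0 h]
    linear_combination this/2
  intro hz
  set g : ℂ → ℂ := fun τ => -ψ τ (1/2) / (2 * X τ * Y τ) with hg
  have hXY : ∀ τ, UHP τ → 2 * X τ * Y τ ≠ 0 := fun τ h => mul_ne_zero (mul_ne_zero two_ne_zero (X_ne h)) (Y_ne h)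
  have main : ∀ τ z, UHP τ → ψ τ z = g τ * (t1 τ z * X τ - t0 τ z * Y τ) := by
    intro τ z h
    have dψ : Differentiable ℂ (ψ τ) := by
      intro z
      have h1 : DifferentiableAt ℂ (fun p : ℂ × ℂ => ψ p.1 p.2) (τ, z) :=
        H.holo.differentiableAt (isOpen_uhp2.mem_nhds h)
      have h2 : DifferentiableAt ℂ (fun z : ℂ => ((τ, z) : ℂ × ℂ)) z := by fun_prop
      exact DifferentiableAt.comp (f := fun z : ℂ => ((τ, z) : ℂ × ℂ)) z h1 h2
    obtain ⟨A, B, hAB⟩ := theta1d h (ψ τ) dψ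
      (fun z => by simpa [eC_zero] using H.ellip 0 1 τ z h)
      (fun z => by
        have := H.ellip 1 0 τ z h
        simp at this
        rw [this]; congr 2; ring)
    have a0 := hAB 0
    have a1 := hAB (0+1/2)
    rw [t0_half h, t1_half h, zero_add] at a1
    rw [hz τ h] at a0
    change 0 = A * X τ + B * Y τ at a0
    change ψ τ (1/2) = A * X τ + B * -Y τ at a1
    have hgB : g τ * X τ = B := by
      simp only [hg]
      have := X_ne h
      have := Y_ne h
      field_simp
      linear_combination -a1+a0
    have hgA : -g τ * Y τ = A := by
      simp only [hg]
      have := X_ne h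
      have := Y_ne h
      field_simp
      linear_combination a1+a0
    rw [hAB z, ← hgA, ← hgB]; ring
  have dP : DifferentiableOn ℂ (fun τ => ψ τ (1/2)) {τ | UHP τ} := by
    refine H.holo.comp (f := fun τ : ℂ => ((τ, 1/2) : ℂ × ℂ)) ?_ (fun τ h => h)
    fun_prop
  have dg : DifferentiableOn ℂ g {τ | UHP τ} :=
    dP.neg.div ((X_holo.const_mul 2).mul Y_holo) (fun τ h => hXY τ h)
  refine ⟨hjf g, hjf_of k hk4 g dg ?_ ?_ ?_, ?_⟩
  · intro τ h
    have e : ψ (τ+1) (1/2) = ψ τ (1/2) := by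
      have := H.transf ModularGroup.T τ (1/2) h
      simpa [Ma, Mb, Mc, Md, ModularGroup.T, eC_zero] using this
    simp only [hg, e, X_T h, Y_T h]
    have := X_ne h
    have := Y_ne h
    field_simp
    linear_combination (-ψ τ (1/2)) * I_sq
  · obtain ⟨c, hc⟩ := jf_bound H
    have im1 : ∀ᶠ τ in iinf, 1 ≤ τ.im := by
      have h0 : Tendsto Complex.im iinf atTop := tendsto_comap
      exact h0.eventually (eventually_ge_atTop 1)
    have hl : Tendsto (fun τ : ℂ => eC τ) iinf (𝓝 0) := by
      refine (eC_lim (c := 1) one_pos).congr fun τ => ?_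
      simp
    have c0 : c = 0 := by
      obtain ⟨C, hC⟩ := hc 0
      have l1 : Tendsto (fun τ : ℂ => C * ‖eC τ‖) iinf (𝓝 0) := by
        simpa using (hl.norm).const_mul C
      have : ‖c‖ ≤ 0 := by
        refine ge_of_tendsto l1 ?_
        filter_upwards [im1] with τ hτ
        have := hC τ hτ
        rw [ofReal_zero, hz τ (lt_of_lt_of_le one_pos hτ)] at this
        simpa using this
      simpa using this
    obtain ⟨C, hC⟩ := hc (1/2)
    have l2 : Tendsto (fun τ : ℂ => ψ τ (1/2) * eC (-(τ/4))) iinf (𝓝 0) := by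
      have l1 : Tendsto (fun τ : ℂ => C * ‖eC (τ*(3/4:ℝ))‖) iinf (𝓝 0) := by
        have := (eC_lim (c := 3/4) (by norm_num)).norm.const_mul C
        rw [norm_zero, mul_zero] at this
        exact this
      refine squeeze_zero_norm' ?_ l1
      filter_upwards [im1] with τ hτ
      have := hC τ hτ
      rw [c0, sub_zero] at this
      push_cast at this
      have e : eC (τ*(3/4:ℝ)) = eC τ * eC (-(τ/4)) := by
        rw [← eC_add]; congr 1; push_cast; ring
      rw [e, norm_mul, norm_mul, ← mul_assoc]
      gcongr
    have l3 : Tendsto (fun τ : ℂ => (2 * X τ * jacobiTheta₂ τ (2*τ))) iinf (𝓝 (2*1*2)) :=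
      (X_lim.const_mul 2).mul w1_lim
    have l4 := l2.neg.div l3 (by norm_num)
    have l5 : Tendsto g iinf (𝓝 (-0/(2*1*2))) := by
      refine l4.congr fun τ => ?_
      simp only [hg]
      have : Y τ = eC (τ/4) * jacobiTheta₂ τ (2*τ) := t1_eq_w τ
      rw [this]
      have e := eC_neg_mul (τ/4)
      have e' : eC (-(τ/4)) = (eC (τ/4))⁻¹ := eq_inv_of_mul_eq_one_left e
      simp only [Pi.div_apply, e']
      have := eC_ne_zero (τ/4)
      field_simp
    exact l5.isBigO_one ℝ
  · intro τ h
    have e1 : ψ (-1/τ) (1/2) = τ^k * (g τ * (X τ^2 - Y τ^2)) := by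
      have := H.transf ModularGroup.S τ (τ/2) h
      simp [Ma, Mb, Mc, Md, ModularGroup.S] at this
      have ne := uhp_ne h
      have a : τ/2/τ = 1/2 := by field_simp
      have b : (τ/2)^2/τ = τ/4 := by field_simp; norm_num
      rw [a, b, main τ (τ/2) h] at this
      have t0h := t0_halfper τ 0
      have t1h := t1_halfper h 0
      rw [zero_add] at t0h t1h
      rw [t0h, t1h] at this
      rw [show (-1/τ) = -1/τ from rfl, this]
      have e := eC_neg_mul (τ/4)
      simp only [add_zero]
      change _ * (_ * (eC (-(τ/4)) * X τ * X τ - eC (-(τ/4)) * Y τ * Y τ)) = _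
      linear_combination (τ^k * g τ * (X τ^2 - Y τ^2)) * e
    have hne := hXY _ (uhp_S h)
    have e2 : 2 * X (-1/τ) * Y (-1/τ) = -I*τ*(X τ^2 - Y τ^2) := by
      rw [X_S h, Y_S h]
      linear_combination (2*(X τ^2 - Y τ^2)) * sS_sq τ
    have hgS : g (-1/τ) * (2 * X (-1/τ) * Y (-1/τ)) = -ψ (-1/τ) (1/2) := by
      simp only [hg]
      exact div_mul_cancel₀ _ hne
    rw [e2, e1] at hgS
    rw [e2] at hne
    have hne2 : X τ^2 - Y τ^2 ≠ 0 := right_ne_zero_of_mul hne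
    apply mul_right_cancel₀ hne2
    linear_combination -hgS
  · intro τ z h
    rw [main τ z h]
    have e : I*(z-z)/2 = 0 := by simp
    have e' : (z+z)/2 = z := by ring
    simp only [hjf, e, e']
    rfl

/-- for `k ≡ 2 (mod 4)` the sequence
`0 → J_{k,1}(O_K) →(π₁) J_{k,1} →(D₀) M_k → 0` is exact. -/
theorem stmt0 (k : ℕ) (hk : 0 < k) (hk4 : k % 4 = 2) :
    (∀ φ ψ : ℂ → ℂ → ℂ → ℂ, IsHJF k 1 φ → IsHJF k 1 ψ →
      (∀ τ z : ℂ, UHP τ → φ τ z z = ψ τ z z) →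
      ∀ τ z₁ z₂ : ℂ, UHP τ → φ τ z₁ z₂ = ψ τ z₁ z₂) ∧
    (∀ ψ : ℂ → ℂ → ℂ, IsJF k 1 ψ →
      ((∀ τ : ℂ, UHP τ → ψ τ 0 = 0) ↔
        ∃ φ : ℂ → ℂ → ℂ → ℂ, IsHJF k 1 φ ∧ ∀ τ z : ℂ, UHP τ → ψ τ z = φ τ z z)) ∧
    (∀ f : ℂ → ℂ, IsMF k f →
      ∃ ψ : ℂ → ℂ → ℂ, IsJF k 1 ψ ∧ ∀ τ : ℂ, UHP τ → ψ τ 0 = f τ) := by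
  exact ⟨part1 k hk4, part2 k hk4, part3 k hk4⟩
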